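/- Let M be a symmetric irreducible r×r 0–1 transition matrix and let A : Σ̂_M → ℝ be Lipschitz continuous. Then there exist a function φ⁺ in the space H of Lipschitz real-valued functions on Σ_M, unique up to an additive constant, and a unique constant λ⁺ ∈ ℝ, such that G⁺_A(φ⁺) = φ⁺ + λ⁺. -/

import Mathlib

open MeasureTheory Filter Topology Real

/-- The one-sided subshift of finite type defined by the 0-1 transition matrix `M`:
sequences `x : ℕ → Fin r` with `M (x j) (x (j+1)) = 1` for all `j`. -/
abbrev Shift (r : ℕ) (M : Fin r → Fin r → Bool) : Type :=
  {x : ℕ → Fin r // ∀ j : ℕ, M (x j) (x (j + 1)) = true}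

variable {r : ℕ} {M : Fin r → Fin r → Bool}

/-- The matrix `M` is irreducible: any symbol can be joined to any other by an
admissible path of positive length. -/
def Irred (M : Fin r → Fin r → Bool) : Prop :=
  ∀ i j : Fin r, ∃ n : ℕ, ∃ w : Fin (n + 2) → Fin r,
    w 0 = i ∧ w (Fin.last (n + 1)) = j ∧
    ∀ k : Fin (n + 1), M (w k.castSucc) (w k.succ) = true

/-- The left shift map on the subshift. -/
def shiftMap (x : Shift r M) : Shift r M :=
  ⟨fun j => x.1 (j + 1), fun j => x.2 (j + 1)⟩

/-- The metric `d(x,y) = Λ^k`, `k = min { j : x_j ≠ y_j }`, `d(x,x) = 0`. -/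
noncomputable def shiftDist (Λ : ℝ) (x y : Shift r M) : ℝ :=
  letI := Classical.decEq (Shift r M)
  if h : x = y then 0
  else Λ ^ Nat.find (show ∃ j : ℕ, x.1 j ≠ y.1 j by
    by_contra hc
    push_neg at hc
    exact h (Subtype.ext (funext hc)))

/-- `φ` is Lipschitz with constant `K` for the metric `shiftDist Λ`. -/
def LipBnd (Λ K : ℝ) (φ : Shift r M → ℝ) : Prop :=
  ∀ x y : Shift r M, |φ x - φ y| ≤ K * shiftDist Λ x y

/-- `φ` is Lipschitz continuous for the metric `shiftDist Λ`. -/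
def IsLip (Λ : ℝ) (φ : Shift r M → ℝ) : Prop :=
  ∃ K : ℝ, LipBnd Λ K φ

/-- The best Lipschitz constant of `φ`. -/
noncomputable def lipC (Λ : ℝ) (φ : Shift r M → ℝ) : ℝ :=
  sInf {K : ℝ | 0 ≤ K ∧ LipBnd Λ K φ}

/-- The uniform norm `‖φ‖₀`. -/
noncomputable def unorm (φ : Shift r M → ℝ) : ℝ :=
  ⨆ x : Shift r M, |φ x|

/-- An observable on the natural extension `Σ̂_M ⊂ Σ*_M × Σ_M` (with `Σ*_M`
canonically identified with `Σ_M`), as a function of `(y, x)`; it is Lipschitz with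
constant `K` for the max-metric. -/
def LipBnd2 (Λ K : ℝ) (A : Shift r M → Shift r M → ℝ) : Prop :=
  ∀ y x y' x' : Shift r M,
    |A y x - A y' x'| ≤ K * max (shiftDist Λ y y') (shiftDist Λ x x')

/-- `A` is Lipschitz continuous on `Σ̂_M`. -/
def IsLip2 (Λ : ℝ) (A : Shift r M → Shift r M → ℝ) : Prop :=
  ∃ K : ℝ, LipBnd2 Λ K A

/-- The best Lipschitz constant of the observable `A`. -/
noncomputable def lipC2 (Λ : ℝ) (A : Shift r M → Shift r M → ℝ) : ℝ :=
  sInf {K : ℝ | 0 ≤ K ∧ LipBnd2 Λ K A}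

/-- The uniform norm `‖A‖₀` of the observable. -/
noncomputable def unorm2 (A : Shift r M → Shift r M → ℝ) : ℝ :=
  ⨆ p : Shift r M × Shift r M, |A p.1 p.2|

/-- `μ` is a `σ`-invariant Borel probability measure on the subshift. -/
def InvProb (μ : Measure (Shift r M)) : Prop :=
  IsProbabilityMeasure μ ∧ μ.map shiftMap = μ

/-- Entropy of the cylinder partition of length `n`:
`H_n(μ) = - ∑_{|w| = n} μ([w]) log μ([w])`. -/
noncomputable def cylEnt (μ : Measure (Shift r M)) (n : ℕ) : ℝ :=
  ∑ w : Fin n → Fin r,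
    Real.negMulLog ((μ {x : Shift r M | ∀ i : Fin n, x.1 i.1 = w i}).toReal)

/-- The Kolmogorov–Sinai entropy `h_μ(σ)` of an invariant measure on the subshift:
since the cylinder partition is generating and `n ↦ H_n(μ)` is subadditive,
`h_μ(σ) = lim_n H_n(μ)/n = inf_n H_n(μ)/n`. -/
noncomputable def entropy (μ : Measure (Shift r M)) : ℝ :=
  ⨅ n : ℕ, cylEnt μ (n + 1) / (n + 1)

/-- The operator
`G⁺_A(φ)(y) = sup_{μ ∈ M_σ} [ ∫ (A(y,x) + φ(x)) dμ(x) + h_μ(σ) ]`. -/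
noncomputable def Gplus (A : Shift r M → Shift r M → ℝ)
    (φ : Shift r M → ℝ) (y : Shift r M) : ℝ :=
  sSup {t : ℝ | ∃ μ : Measure (Shift r M), InvProb μ ∧
    t = ∫ x, (A y x + φ x) ∂μ + entropy μ}

/-- The maximal ergodic average `max_{μ ∈ M_σ} ∫ B dμ`. -/
noncomputable def maxErg (B : Shift r M → ℝ) : ℝ :=
  sSup {t : ℝ | ∃ μ : Measure (Shift r M), InvProb μ ∧ t = ∫ x, B x ∂μ}

/-- The quotient norm on functions modulo additive constants:
`‖g‖_c = inf_{γ ∈ ℝ} ‖g + γ‖₀`. -/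
noncomputable def cnorm (g : Shift r M → ℝ) : ℝ :=
  ⨅ γ : ℝ, unorm (fun x => g x + γ)



instance shiftCompact : CompactSpace (Shift r M) := by
  refine (isCompact_iff_compactSpace (s := {x : ℕ → Fin r | ∀ j : ℕ, M (x j) (x (j + 1)) = true})).mp ?_
  apply IsClosed.isCompact
  have : {x : ℕ → Fin r | ∀ j : ℕ, M (x j) (x (j + 1)) = true}
      = ⋂ j, {x : ℕ → Fin r | M (x j) (x (j + 1)) = true} := by
    ext; simp
  change IsClosed {x : ℕ → Fin r | ∀ j : ℕ, M (x j) (x (j + 1)) = true}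
  rw [this]
  refine isClosed_iInter fun j => ?_
  have hc : Continuous fun x : ℕ → Fin r => M (x j) (x (j + 1)) := by
    have h2 : Continuous fun p : Fin r × Fin r => M p.1 p.2 := continuous_of_discreteTopology
    have h3 : Continuous fun x : ℕ → Fin r => (x j, x (j + 1)) := by fun_prop
    exact h2.comp h3
  exact isClosed_eq hc continuous_const

instance shiftSC : SecondCountableTopology (Shift r M) :=
  TopologicalSpace.Subtype.secondCountableTopology
    {x : ℕ → Fin r | ∀ j : ℕ, M (x j) (x (j + 1)) = true}

instance shiftMetrizable : TopologicalSpace.MetrizableSpace (Shift r M) :=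
  TopologicalSpace.metrizableSpace_of_t3_secondCountable _

instance shiftOuter : HasOuterApproxClosed (Shift r M) := inferInstance

/-- agreement on first n coordinates -/
def Agree (n : ℕ) (x y : Shift r M) : Prop := ∀ i < n, x.1 i = y.1 i

/-- Lipschitz in terms of agreement. -/
def ALip (Λ K : ℝ) (f : Shift r M → ℝ) : Prop :=
  ∀ n x y, Agree n x y → |f x - f y| ≤ K * Λ ^ n

lemma agree_zero (x y : Shift r M) : Agree 0 x y := fun i hi => absurd hi (by omega)

lemma isOpen_agree (n : ℕ) (x : Shift r M) : IsOpen {y : Shift r M | Agree n x y} := by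
  have : {y : Shift r M | Agree n x y} = ⋂ i ∈ Set.Iio n, {y : Shift r M | x.1 i = y.1 i} := by
    ext; simp [Agree]
  rw [this]
  refine (Set.finite_Iio n).isOpen_biInter fun i _ => ?_
  have hc : Continuous fun y : Shift r M => y.1 i :=
    (continuous_apply i).comp continuous_subtype_val
  exact (isOpen_discrete {a | x.1 i = a}).preimage hc

lemma exists_small {Λ : ℝ} (hΛ : Λ ∈ Set.Ioo (0 : ℝ) 1) (K : ℝ) {ε : ℝ} (hε : 0 < ε) :
    ∃ n : ℕ, K * Λ ^ n < ε := by
  have h : Tendsto (fun n : ℕ => K * Λ ^ n) atTop (𝓝 (K * 0)) :=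
    (tendsto_pow_atTop_nhds_zero_of_lt_one hΛ.1.le hΛ.2).const_mul K
  rw [mul_zero] at h
  exact (h.eventually (gt_mem_nhds hε)).exists

lemma ALip.continuous {Λ K : ℝ} (hΛ : Λ ∈ Set.Ioo (0 : ℝ) 1) {f : Shift r M → ℝ}
    (h : ALip Λ K f) : Continuous f := by
  rw [continuous_iff_continuousAt]
  intro x
  rw [ContinuousAt, Metric.tendsto_nhds]
  intro ε hε
  obtain ⟨n, hn⟩ := exists_small hΛ K hε
  filter_upwards [(isOpen_agree n x).mem_nhds (show Agree n x x from fun _ _ => rfl)] with y hy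
  rw [dist_comm, Real.dist_eq]
  exact (h n x y hy).trans_lt hn

lemma shiftDist_le {Λ : ℝ} (hΛ : Λ ∈ Set.Ioo (0 : ℝ) 1) {n : ℕ} {x y : Shift r M}
    (h : Agree n x y) : shiftDist Λ x y ≤ Λ ^ n := by
  unfold shiftDist
  split_ifs with hxy
  · exact pow_nonneg hΛ.1.le _
  · apply pow_le_pow_of_le_one hΛ.1.le hΛ.2.le
    rw [Nat.le_find_iff]
    intro m hm
    simpa using h m hm

lemma shiftDist_nonneg {Λ : ℝ} (hΛ : Λ ∈ Set.Ioo (0 : ℝ) 1) (x y : Shift r M) :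
    0 ≤ shiftDist Λ x y := by
  unfold shiftDist
  split_ifs with hxy
  · exact le_rfl
  · exact pow_nonneg hΛ.1.le _

lemma shiftDist_eq {Λ : ℝ} (x y : Shift r M) (hxy : x ≠ y) :
    ∃ n, Agree n x y ∧ shiftDist Λ x y = Λ ^ n := by
  unfold shiftDist
  rw [dif_neg hxy]
  refine ⟨_, ?_, rfl⟩
  intro i hi
  simpa using Nat.find_min _ hi

lemma ALip.lipBnd {Λ K : ℝ} {f : Shift r M → ℝ} (h : ALip Λ K f) : LipBnd Λ K f := by
  intro x y
  by_cases hxy : x = y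
  · subst hxy; simp [shiftDist]
  · obtain ⟨n, h1, h2⟩ := shiftDist_eq (Λ := Λ) x y hxy
    rw [h2]; exact h n x y h1

lemma LipBnd.aLip {Λ K : ℝ} (hΛ : Λ ∈ Set.Ioo (0 : ℝ) 1) {f : Shift r M → ℝ}
    (h : LipBnd Λ K f) : ALip Λ |K| f := by
  intro n x y hxy
  calc |f x - f y| ≤ K * shiftDist Λ x y := h x y
    _ ≤ |K| * shiftDist Λ x y := by
      gcongr
      · exact shiftDist_nonneg hΛ _ _
      · exact le_abs_self K
    _ ≤ _ := by gcongr; exact shiftDist_le hΛ hxy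

lemma ALip.add {Λ K K' : ℝ} {f g : Shift r M → ℝ} (hf : ALip Λ K f) (hg : ALip Λ K' g) :
    ALip Λ (K + K') (fun x => f x + g x) := by
  intro n x y hxy
  have h1 := hf n x y hxy
  have h2 := hg n x y hxy
  rw [add_mul]
  calc |f x + g x - (f y + g y)| = |(f x - f y) + (g x - g y)| := by ring_nf
    _ ≤ _ := (abs_add_le _ _).trans (add_le_add h1 h2)

lemma ALip.neg {Λ K : ℝ} {f : Shift r M → ℝ} (hf : ALip Λ K f) :
    ALip Λ K (fun x => - f x) := by
  intro n x y hxy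
  have h1 := hf n x y hxy
  rwa [← abs_neg, show -(-f x - -f y) = f x - f y by ring]

lemma ALip.const (Λ c : ℝ) : ALip Λ 0 (fun _ : Shift r M => c) := by
  intro n x y hxy
  simp

lemma agree_shift {n : ℕ} {x y : Shift r M} (h : Agree (n+1) x y) :
    Agree n (shiftMap x) (shiftMap y) := fun i hi => h (i+1) (by omega)

lemma ALip.shift {Λ K : ℝ} (hΛ : Λ ∈ Set.Ioo (0 : ℝ) 1) (hK : 0 ≤ K) {f : Shift r M → ℝ}
    (hf : ALip Λ K f) : ALip Λ (K / Λ) (fun x => f (shiftMap x)) := by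
  intro n x y hxy
  have h0 := hΛ.1
  cases n with
  | zero =>
    have := hf 0 _ _ (agree_zero (shiftMap x) (shiftMap y))
    simp only [pow_zero, mul_one] at this ⊢
    exact this.trans (le_div_self hK hΛ.1 hΛ.2.le)
  | succ n =>
    have := hf n _ _ (agree_shift hxy)
    refine this.trans (le_of_eq ?_)
    rw [pow_succ]; field_simp

lemma continuous_shiftMap : Continuous (shiftMap : Shift r M → Shift r M) := by
  unfold shiftMap
  refine Continuous.subtype_mk ?_ _
  exact continuous_pi fun j => (continuous_apply (j+1)).comp continuous_subtype_val

/-- prepend a symbol (junk value if not admissible) -/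
def pre (a : Fin r) (x : Shift r M) : Shift r M :=
  if h : M a (x.1 0) = true then
    ⟨fun n => Nat.casesOn n a x.1, fun j => by cases j with
      | zero => exact h
      | succ j => exact x.2 j⟩
  else x

lemma pre_zero {a : Fin r} {x : Shift r M} (h : M a (x.1 0) = true) : (pre a x).1 0 = a := by
  simp [pre, h]

lemma pre_succ {a : Fin r} {x : Shift r M} (h : M a (x.1 0) = true) (n : ℕ) :
    (pre a x).1 (n+1) = x.1 n := by
  simp [pre, h]

lemma shift_pre {a : Fin r} {x : Shift r M} (h : M a (x.1 0) = true) :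
    shiftMap (pre a x) = x := by
  apply Subtype.ext; funext n; exact pre_succ h n

lemma pre_shift (x : Shift r M) : pre (x.1 0) (shiftMap x) = x := by
  have h : M (x.1 0) ((shiftMap x).1 0) = true := x.2 0
  apply Subtype.ext; funext n
  cases n with
  | zero => exact pre_zero h
  | succ n => rw [pre_succ h]; rfl

lemma pre_agree {a : Fin r} {n : ℕ} {x y : Shift r M} (h : M a (x.1 0) = true)
    (h' : M a (y.1 0) = true) (hxy : Agree n x y) : Agree (n+1) (pre a x) (pre a y) := by
  intro i hi
  cases i with
  | zero => rw [pre_zero h, pre_zero h']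
  | succ i => rw [pre_succ h, pre_succ h']; exact hxy i (by omega)

lemma continuous_coord (j : ℕ) : Continuous fun x : Shift r M => x.1 j :=
  (continuous_apply j).comp continuous_subtype_val

lemma continuous_pre (a : Fin r) : Continuous (pre a : Shift r M → Shift r M) := by
  refine continuous_induced_rng.mpr ?_
  refine continuous_pi fun j => ?_
  have h : (fun x : Shift r M => (pre a x).1 j) = fun x =>
      (fun p : Fin r × Fin r × Fin r =>
        if M a p.1 = true then (if j = 0 then a else p.2.1) else p.2.2)
        (x.1 0, x.1 (j-1), x.1 j) := by
    funext x
    by_cases hM : M a (x.1 0) = true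
    · cases j with
      | zero => simp [pre_zero hM, hM]
      | succ j => simp [pre_succ hM, hM]
    · simp [pre, hM]
  change Continuous (fun x : Shift r M => (pre a x).1 j)
  rw [h]
  exact (continuous_of_discreteTopology (f := fun p : Fin r × Fin r × Fin r =>
        if M a p.1 = true then (if j = 0 then a else p.2.1) else p.2.2)).comp
    ((continuous_coord 0).prodMk ((continuous_coord (j-1)).prodMk (continuous_coord j)))

lemma irred_pred (hIrr : Irred M) (i : Fin r) : ∃ a, M a i = true := by
  obtain ⟨n, w, h1, h2, h3⟩ := hIrr i i
  refine ⟨w (Fin.last n).castSucc, ?_⟩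
  have := h3 (Fin.last n)
  rwa [Fin.succ_last, h2] at this

lemma irred_succ (hIrr : Irred M) (i : Fin r) : ∃ a, M i a = true := by
  obtain ⟨n, w, h1, h2, h3⟩ := hIrr i i
  refine ⟨w (Fin.succ 0), ?_⟩
  have := h3 0
  rwa [Fin.castSucc_zero, h1] at this

lemma irred_reach (hIrr : Irred M) (i j : Fin r) :
    Relation.ReflTransGen (fun a b => M a b = true) i j := by
  obtain ⟨n, w, h1, h2, h3⟩ := hIrr i j
  have key : ∀ k : Fin (n+2), Relation.ReflTransGen (fun a b => M a b = true) i (w k) := by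
    intro k
    induction k using Fin.induction with
    | zero => rw [h1]
    | succ k ih => exact ih.tail (h3 k)
  rw [← h2]; exact key _

lemma exists_point (hIrr : Irred M) (i : Fin r) : ∃ x : Shift r M, x.1 0 = i := by
  choose s hs using irred_succ hIrr
  refine ⟨⟨fun n => s^[n] i, fun j => ?_⟩, rfl⟩
  change M (s^[j] i) (s^[j+1] i) = true
  rw [Function.iterate_succ_apply']
  exact hs _

lemma reach_bound (hIrr : Irred M) (i j : Fin r) : ∃ N : ℕ, ∀ (v : Shift r M → ℝ) (D : ℝ),
    (∀ a x, M a (x.1 0) = true → v (pre a x) ≤ v x + D) →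
    ∀ x : Shift r M, x.1 0 = j → ∃ z : Shift r M, z.1 0 = i ∧ v z ≤ v x + N * D := by
  induction irred_reach hIrr i j using Relation.ReflTransGen.head_induction_on with
  | refl => exact ⟨0, fun v D h x hx => ⟨x, hx, by simp⟩⟩
  | head h _ ih =>
    obtain ⟨N, hN⟩ := ih
    refine ⟨N+1, fun v D h' x hx => ?_⟩
    obtain ⟨z, hz, hz2⟩ := hN v D h' x hx
    rw [← hz] at h
    refine ⟨_, pre_zero h, (h' _ z h).trans ?_⟩
    push_cast; linarith

lemma reach_point (hIrr : Irred M) (i : Fin r) (x : Shift r M) :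
    ∃ (k : ℕ) (z : Shift r M), z.1 0 = i ∧ shiftMap^[k] z = x := by
  induction irred_reach hIrr i (x.1 0) using Relation.ReflTransGen.head_induction_on with
  | refl => exact ⟨0, x, rfl, rfl⟩
  | head h _ ih =>
    obtain ⟨k, z, hz, hz2⟩ := ih
    rw [← hz] at h
    exact ⟨k+1, _, pre_zero h, by rw [Function.iterate_succ_apply, shift_pre h, hz2]⟩

lemma iterate_shift_coord (n : ℕ) (x : Shift r M) (j : ℕ) :
    (shiftMap^[n] x).1 j = x.1 (n + j) := by
  induction n generalizing x with
  | zero => simp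
  | succ n ih =>
    rw [Function.iterate_succ_apply, ih]
    change x.1 (n + j + 1) = _
    rw [show n + j + 1 = n + 1 + j by omega]

lemma splice (y : Shift r M) (n : ℕ) : ∀ z : Shift r M, z.1 0 = y.1 n →
    ∃ z', Agree (n+1) z' y ∧ shiftMap^[n] z' = z := by
  induction n with
  | zero =>
    intro z hz
    refine ⟨z, fun i hi => ?_, rfl⟩
    obtain rfl : i = 0 := by omega
    exact hz
  | succ n ih =>
    intro z hz
    have h : M (y.1 n) (z.1 0) = true := by rw [hz]; exact y.2 n
    obtain ⟨z', h1, h2⟩ := ih (pre (y.1 n) z) (pre_zero h)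
    have h3 : shiftMap^[n+1] z' = z := by
      rw [Function.iterate_succ_apply', h2, shift_pre h]
    refine ⟨z', fun i hi => ?_, h3⟩
    by_cases hi' : i < n+1
    · exact h1 i hi'
    · obtain rfl : i = n+1 := by omega
      have := iterate_shift_coord (n+1) z' 0
      rw [h3] at this
      rw [← hz, this, add_zero]


lemma isCompact_alip {Λ : ℝ} (hΛ : Λ ∈ Set.Ioo (0 : ℝ) 1) (K : ℝ) (x0 : Shift r M) :
    IsCompact {u : C(Shift r M, ℝ) | ALip Λ K u ∧ u x0 = 0} := by
  apply ArzelaAscoli.isCompact_of_equicontinuous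
  · have h1 : ContinuousMap.toFun '' {u : C(Shift r M, ℝ) | ALip Λ K u ∧ u x0 = 0}
        = {f : Shift r M → ℝ | ALip Λ K f ∧ f x0 = 0} := by
      ext f
      constructor
      · rintro ⟨u, hu, rfl⟩; exact hu
      · intro hf; exact ⟨⟨f, hf.1.continuous hΛ⟩, hf, rfl⟩
    rw [h1]
    refine IsCompact.of_isClosed_subset
      (isCompact_univ_pi (fun _ : Shift r M => isCompact_Icc (a := -K) (b := K))) ?_ ?_
    · have h2 : {f : Shift r M → ℝ | ALip Λ K f ∧ f x0 = 0}
          = (⋂ (n : ℕ) (x : Shift r M) (y : Shift r M) (_ : Agree n x y),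
            {f : Shift r M → ℝ | |f x - f y| ≤ K * Λ ^ n}) ∩ {f | f x0 = 0} := by
        ext f; simp [ALip]
      rw [h2]
      refine IsClosed.inter ?_ (isClosed_eq (continuous_apply _) continuous_const)
      refine isClosed_iInter fun n => isClosed_iInter fun x => isClosed_iInter fun y =>
        isClosed_iInter fun _ => ?_
      exact isClosed_le ((continuous_apply x).sub (continuous_apply y)).abs continuous_const
    · intro f hf x _
      have := hf.1 0 x x0 (agree_zero _ _)
      rw [hf.2, sub_zero, pow_zero, mul_one, abs_le] at this
      exact this
  · intro x
    rw [Metric.equicontinuousAt_iff_right]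
    intro ε hε
    obtain ⟨n, hn⟩ := exists_small hΛ K hε
    filter_upwards [(isOpen_agree n x).mem_nhds (show Agree n x x from fun _ _ => rfl)] with y hy u
    rw [Real.dist_eq]
    exact (u.2.1 n x y hy).trans_lt hn

/-- local Lipschitz condition -/
def LLip (Λ C : ℝ) (u : Shift r M → ℝ) : Prop :=
  ∀ n x y, Agree (n+1) x y → |u x - u y| ≤ C * Λ ^ (n+1)

lemma nonexp {T : C(Shift r M, ℝ) → C(Shift r M, ℝ)}
    (hmono : ∀ φ ψ : C(Shift r M, ℝ), (∀ x, φ x ≤ ψ x) → ∀ x, T φ x ≤ T ψ x)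
    (hadd : ∀ (φ : C(Shift r M, ℝ)) (c : ℝ), T (φ + ContinuousMap.const _ c) =
      T φ + ContinuousMap.const _ c) (φ ψ : C(Shift r M, ℝ)) : dist (T φ) (T ψ) ≤ dist φ ψ := by
  have key : ∀ φ ψ : C(Shift r M, ℝ), ∀ x, T φ x ≤ T ψ x + dist φ ψ := by
    intro φ ψ x
    have h := hmono φ (ψ + ContinuousMap.const _ (dist φ ψ)) (fun y => by
      have := ContinuousMap.dist_apply_le_dist (f := φ) (g := ψ) y
      rw [Real.dist_eq, abs_le] at this
      simp; linarith [this.2]) x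
    rw [hadd] at h
    simpa using h
  rw [ContinuousMap.dist_le dist_nonneg]
  intro x
  rw [Real.dist_eq, abs_le]
  have h1 := key φ ψ x
  have h2 := key ψ φ x
  rw [dist_comm ψ φ] at h2
  constructor <;> linarith

lemma exists_fixed {Λ : ℝ} (hΛ : Λ ∈ Set.Ioo (0 : ℝ) 1) (x0 : Shift r M)
    (T : C(Shift r M, ℝ) → C(Shift r M, ℝ))
    (hmono : ∀ φ ψ : C(Shift r M, ℝ), (∀ x, φ x ≤ ψ x) → ∀ x, T φ x ≤ T ψ x)
    (hadd : ∀ (φ : C(Shift r M, ℝ)) (c : ℝ), T (φ + ContinuousMap.const _ c) =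
      T φ + ContinuousMap.const _ c)
    (C : ℝ) (hC : 0 ≤ C) (hS : ∀ (φ : C(Shift r M, ℝ)) (t : ℝ), t ∈ Set.Icc (0:ℝ) 1 →
      LLip Λ C φ → LLip Λ C (T (t • φ)))
    (B : ℝ) (hB : ∀ (u : C(Shift r M, ℝ)) (t : ℝ), t ∈ Set.Icc (0:ℝ) 1 → LLip Λ C u →
      T (t • u) = u → (1 - t) * ‖u‖ ≤ ‖T 0‖ → ∀ x y, |u x - u y| ≤ B) :
    ∃ (u : C(Shift r M, ℝ)) (lam : ℝ), ALip Λ (max C B) u ∧ ∀ x, T u x = u x + lam := by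
  have hne := nonexp hmono hadd
  have hfix : ∀ t : ℝ, t ∈ Set.Ico (0:ℝ) 1 → ∃ u : C(Shift r M, ℝ),
      LLip Λ C u ∧ T (t • u) = u ∧ (1 - t) * ‖u‖ ≤ ‖T 0‖ := by
    intro t ht
    have hc : ContractingWith ⟨t, ht.1⟩ (fun u => T (t • u)) := by
      refine ⟨by exact_mod_cast ht.2, LipschitzWith.of_dist_le_mul fun u v => ?_⟩
      refine (hne _ _).trans ?_
      change dist (t • u) (t • v) ≤ t * dist u v
      rw [dist_eq_norm, dist_eq_norm, ← smul_sub, norm_smul, Real.norm_eq_abs, abs_of_nonneg ht.1]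
    have hfp : T (t • hc.fixedPoint) = hc.fixedPoint := hc.fixedPoint_isFixedPt
    refine ⟨hc.fixedPoint, ?_, hfp, ?_⟩
    · have hcl : IsClosed {u : C(Shift r M, ℝ) | LLip Λ C u} := by
        have h2 : {u : C(Shift r M, ℝ) | LLip Λ C u}
          = (⋂ (n : ℕ) (x : Shift r M) (y : Shift r M) (_ : Agree (n+1) x y),
            {f : C(Shift r M, ℝ) | |f x - f y| ≤ C * Λ ^ (n+1)}) := by
          ext f; simp [LLip]
        rw [h2]
        refine isClosed_iInter fun n => isClosed_iInter fun x => isClosed_iInter fun y =>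
          isClosed_iInter fun _ => ?_
        exact isClosed_le ((continuous_eval_const x).sub
          (continuous_eval_const y)).abs continuous_const
      refine hcl.mem_of_tendsto (hc.tendsto_iterate_fixedPoint 0) (Eventually.of_forall fun k => ?_)
      induction k with
      | zero =>
        intro n x y _
        simp only [Function.iterate_zero, id_eq, ContinuousMap.zero_apply, sub_zero, abs_zero]
        have := hΛ.1
        positivity
      | succ k ih =>
        simp only [Function.iterate_succ_apply']
        exact hS _ t ⟨ht.1, ht.2.le⟩ ih
    · have h1 := hne (t • hc.fixedPoint) 0
      rw [hfp, dist_zero_right, norm_smul, Real.norm_eq_abs, abs_of_nonneg ht.1, dist_eq_norm] at h1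
      have h2 := norm_sub_norm_le hc.fixedPoint (T 0)
      linarith
  have htk : ∀ k : ℕ, (1 - 1 / ((k:ℝ) + 1)) ∈ Set.Ico (0:ℝ) 1 := by
    intro k
    have hk : (0:ℝ) < k + 1 := by positivity
    constructor
    · rw [sub_nonneg, div_le_one hk]; linarith [(Nat.cast_nonneg k : (0:ℝ) ≤ k)]
    · have : 0 < 1 / ((k:ℝ) + 1) := by positivity
      linarith
  choose u hu1 hu2 hu3 using fun k => hfix _ (htk k)
  set t : ℕ → ℝ := fun k => 1 - 1 / ((k:ℝ) + 1) with ht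
  have htlim : Tendsto t atTop (𝓝 1) := by
    have := (tendsto_one_div_add_atTop_nhds_zero_nat (𝕜 := ℝ)).const_sub 1
    rw [sub_zero] at this; exact this
  set v : ℕ → C(Shift r M, ℝ) := fun k => u k + ContinuousMap.const _ (-(u k x0)) with hv
  have hvmem : ∀ k, v k ∈ {u : C(Shift r M, ℝ) | ALip Λ (max C B) u ∧ u x0 = 0} := by
    intro k
    refine ⟨?_, by simp [hv]⟩
    intro n x y hxy
    have hvv : v k x - v k y = u k x - u k y := by simp [hv]
    rw [hvv]
    cases n with
    | zero =>
      have := hB (u k) _ (Set.Ico_subset_Icc_self (htk k)) (hu1 k) (hu2 k) (hu3 k) x y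
      rw [pow_zero, mul_one]; exact this.trans (le_max_right _ _)
    | succ n =>
      refine (hu1 k n x y hxy).trans ?_
      have := hΛ.1
      gcongr; exact le_max_left _ _
  have hcmem : ∀ k, (1 - t k) * u k x0 ∈ Set.Icc (-‖T 0‖) ‖T 0‖ := by
    intro k
    have h1 : 0 ≤ 1 - t k := by have := (htk k).2; simp only [ht]; linarith
    rw [Set.mem_Icc, ← abs_le, abs_mul, abs_of_nonneg h1]
    refine le_trans ?_ (hu3 k)
    exact mul_le_mul_of_nonneg_left ((u k).norm_coe_le_norm x0) h1
  obtain ⟨⟨w, lam⟩, hw, s, hs, hlim⟩ := ((isCompact_alip hΛ (max C B) x0).prod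
    (isCompact_Icc (a := -‖T 0‖) (b := ‖T 0‖))).tendsto_subseq
    (x := fun k => (v k, (1 - t k) * u k x0)) (fun k => ⟨hvmem k, hcmem k⟩)
  refine ⟨w, lam, hw.1.1, ?_⟩
  rw [Prod.tendsto_iff] at hlim
  obtain ⟨hl1, hl2⟩ := hlim
  have hTc : Continuous T := by
    have : LipschitzWith 1 T := LipschitzWith.of_dist_le_mul fun a b => by simpa using hne a b
    exact this.continuous
  have heq : ∀ k, T (t k • v k) = v k + ContinuousMap.const _ ((1 - t k) * u k x0) := by
    intro k
    have h1 : t k • v k = t k • u k + ContinuousMap.const _ (t k * -(u k x0)) := by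
      ext x; simp [hv, mul_add]
    rw [h1, hadd, hu2]
    ext x; simp [hv]; ring
  intro x
  have hA : Tendsto (fun k => T (t (s k) • v (s k)) x) atTop (𝓝 (T w x)) := by
    have h1 : Tendsto (fun k => t (s k) • v (s k)) atTop (𝓝 ((1:ℝ) • w)) :=
      (htlim.comp hs.tendsto_atTop).smul hl1
    rw [one_smul] at h1
    exact ((continuous_eval_const x).tendsto _).comp ((hTc.tendsto w).comp h1)
  have hBl : Tendsto (fun k => T (t (s k) • v (s k)) x) atTop (𝓝 (w x + lam)) := by
    simp only [heq, ContinuousMap.add_apply, ContinuousMap.const_apply]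
    exact (((continuous_eval_const x).tendsto _).comp hl1).add hl2
  exact tendsto_nhds_unique hA hBl


/-- admissibility indicator -/
noncomputable def mm (a : Fin r) (x : Shift r M) : ℝ := if M a (x.1 0) = true then 1 else 0

lemma mm_nonneg (a : Fin r) (x : Shift r M) : 0 ≤ mm a x := by
  unfold mm; split_ifs <;> norm_num

lemma continuous_mm (a : Fin r) : Continuous (mm a : Shift r M → ℝ) := by
  have h : Continuous (fun b : Fin r => if M a b = true then (1:ℝ) else 0) :=
    continuous_of_discreteTopology
  exact h.comp (continuous_coord 0)

/-- transfer sum -/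
noncomputable def tsm (f : Shift r M → ℝ) (x : Shift r M) : ℝ :=
  ∑ a, mm a x * Real.exp (f (pre a x))

lemma tsm_pos (hIrr : Irred M) (f : Shift r M → ℝ) (x : Shift r M) : 0 < tsm f x := by
  obtain ⟨a, ha⟩ := irred_pred hIrr (x.1 0)
  refine Finset.sum_pos' (fun b _ => mul_nonneg (mm_nonneg _ _) (Real.exp_pos _).le)
    ⟨a, Finset.mem_univ _, ?_⟩
  simp [mm, ha, Real.exp_pos]

lemma le_log_tsm {f : Shift r M → ℝ} {a : Fin r} {x : Shift r M}
    (h : M a (x.1 0) = true) : f (pre a x) ≤ Real.log (tsm f x) := by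
  have h1 : Real.exp (f (pre a x)) ≤ tsm f x := by
    have := Finset.single_le_sum (f := fun a => mm a x * Real.exp (f (pre a x)))
      (fun b _ => mul_nonneg (mm_nonneg _ _) (Real.exp_pos _).le) (Finset.mem_univ a)
    simpa [mm, h, tsm] using this
  rw [← Real.log_exp (f (pre a x))]
  exact Real.log_le_log (Real.exp_pos _) h1

lemma log_tsm_le (hIrr : Irred M) {f g : Shift r M → ℝ} {x y : Shift r M} {c : ℝ}
    (h0 : x.1 0 = y.1 0)
    (h : ∀ a, M a (x.1 0) = true → f (pre a x) ≤ g (pre a y) + c) :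
    Real.log (tsm f x) ≤ Real.log (tsm g y) + c := by
  have h1 : tsm f x ≤ tsm g y * Real.exp c := by
    unfold tsm
    rw [Finset.sum_mul]
    refine Finset.sum_le_sum fun a _ => ?_
    by_cases ha : M a (x.1 0) = true
    · have hb := ha
      rw [h0] at hb
      simp only [mm, ha, hb, if_true, one_mul]
      rw [← Real.exp_add]
      exact Real.exp_le_exp.mpr (h a ha)
    · have hb := ha
      rw [h0] at hb
      simp [mm, ha, hb]
  calc _ ≤ Real.log (tsm g y * Real.exp c) := Real.log_le_log (tsm_pos hIrr f x) h1
    _ = _ := by rw [Real.log_mul (tsm_pos hIrr g y).ne' (Real.exp_pos _).ne', Real.log_exp]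

lemma continuous_tsm {f : Shift r M → ℝ} (hf : Continuous f) : Continuous (tsm f) := by
  unfold tsm
  refine continuous_finsetSum _ fun a _ => (continuous_mm a).mul ?_
  exact Real.continuous_exp.comp (hf.comp (continuous_pre a))

lemma eigen (hIrr : Irred M) {Λ : ℝ} (hΛ : Λ ∈ Set.Ioo (0 : ℝ) 1) (x0 : Shift r M)
    {f : Shift r M → ℝ} {K : ℝ} (hK : 0 ≤ K) (hf : ALip Λ K f) :
    ∃ (u : Shift r M → ℝ) (p K' : ℝ), 0 ≤ K' ∧ ALip Λ K' u ∧
      ∀ x, tsm (fun z => f z + u z) x = Real.exp (u x + p) := by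
  have hfc := hf.continuous hΛ
  let T : C(Shift r M, ℝ) → C(Shift r M, ℝ) := fun u =>
    ⟨fun x => Real.log (tsm (fun z => f z + u z) x),
      (continuous_tsm (hfc.add u.continuous)).log fun x => (tsm_pos hIrr _ x).ne'⟩
  have hT : ∀ u x, T u x = Real.log (tsm (fun z => f z + u z) x) := fun _ _ => rfl
  have hΛ0 := hΛ.1
  have h1Λ : 0 < 1 - Λ := by linarith [hΛ.2]
  set C : ℝ := K * Λ / (1 - Λ) with hCdef
  have hC : 0 ≤ C := by positivity
  have hCeq : (K + C) * Λ = C := by rw [hCdef]; field_simp; ring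
  have hmono : ∀ φ ψ : C(Shift r M, ℝ), (∀ x, φ x ≤ ψ x) → ∀ x, T φ x ≤ T ψ x := by
    intro φ ψ h x
    have := log_tsm_le hIrr (f := fun z => f z + φ z) (g := fun z => f z + ψ z) (x := x) (y := x)
      (c := 0) rfl (fun a _ => by have := h (pre a x); linarith)
    simpa [hT] using this
  have hadd : ∀ (φ : C(Shift r M, ℝ)) (c : ℝ), T (φ + ContinuousMap.const _ c) =
      T φ + ContinuousMap.const _ c := by
    intro φ c
    ext x
    have h1 := log_tsm_le hIrr (f := fun z => f z + (φ z + c))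
      (g := fun z => f z + φ z) (x := x) (y := x)
      (c := c) rfl (fun a _ => by linarith)
    have h2 := log_tsm_le hIrr (g := fun z => f z + (φ z + c))
      (f := fun z => f z + φ z) (x := x) (y := x)
      (c := -c) rfl (fun a _ => by linarith)
    simp only [hT, ContinuousMap.add_apply, ContinuousMap.const_apply] at h1 h2 ⊢
    linarith
  have hS : ∀ (φ : C(Shift r M, ℝ)) (t : ℝ), t ∈ Set.Icc (0:ℝ) 1 →
      LLip Λ C φ → LLip Λ C (T (t • φ)) := by
    intro φ t ht hφ
    have key : ∀ n x y, Agree (n+1) x y → T (t • φ) x ≤ T (t • φ) y + C * Λ^(n+1) := by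
      intro n x y hxy
      have h0 : x.1 0 = y.1 0 := hxy 0 (by omega)
      refine log_tsm_le hIrr h0 fun a ha => ?_
      have hag := pre_agree ha (by rw [← h0]; exact ha) hxy
      have h1 := (abs_le.mp (hf _ _ _ hag)).2
      have h2 := (abs_le.mp (hφ _ _ _ hag)).2
      have h3 : C * Λ^(n+1) = K * Λ^(n+1+1) + C * Λ^(n+1+1) := by
        rw [← add_mul, pow_succ Λ (n+1), mul_comm (Λ^(n+1)) Λ, ← mul_assoc, hCeq]
      rw [h3]
      simp only [ContinuousMap.smul_apply, smul_eq_mul]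
      have h4 : 0 ≤ C * Λ^(n+1+1) := by positivity
      nlinarith [ht.1, ht.2, mul_le_mul_of_nonneg_left h2 ht.1, mul_nonneg (sub_nonneg.mpr ht.2) h4]
    intro n x y hxy
    have h1 := key n x y hxy
    have h2 := key n y x (fun i hi => (hxy i hi).symm)
    rw [abs_le]; constructor <;> linarith
  choose N hN using fun i j => reach_bound hIrr i j
  let fC : C(Shift r M, ℝ) := ⟨f, hfc⟩
  set D : ℝ := ‖fC‖ + ‖T 0‖ with hD
  have hD0 : 0 ≤ D := by positivity
  set NN : ℕ := ∑ i, ∑ j, N i j with hNN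
  have hNle : ∀ i j, N i j ≤ NN := fun i j =>
    (Finset.single_le_sum (f := fun j => N i j) (fun _ _ => Nat.zero_le _) (Finset.mem_univ j)).trans
    (Finset.single_le_sum (f := fun i => ∑ j, N i j) (fun _ _ => Nat.zero_le _) (Finset.mem_univ i))
  obtain ⟨u, lam, hu1, hu2⟩ := exists_fixed hΛ x0 T hmono hadd C hC hS (NN * D + C * Λ) (by
    intro u t ht huL hfix hnorm
    have hstep : ∀ a x, M a (x.1 0) = true → u (pre a x) ≤ u x + D := by
      intro a x ha
      have h1 := le_log_tsm (f := fun z => f z + (t • u) z) ha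
      rw [← hT, hfix] at h1
      simp only [ContinuousMap.smul_apply, smul_eq_mul] at h1
      have h2 := (abs_le.mp (fC.norm_coe_le_norm (pre a x))).1
      have h3 := (abs_le.mp (u.norm_coe_le_norm (pre a x))).2
      have h4 := mul_le_mul_of_nonneg_left h3 (sub_nonneg.mpr ht.2)
      change -‖fC‖ ≤ f (pre a x) at h2
      rw [hD]; linarith
    have key : ∀ x y, u y ≤ u x + (NN * D + C * Λ) := by
      intro x y
      obtain ⟨z, hz, hz2⟩ := hN (y.1 0) (x.1 0) u D hstep x rfl
      have h1 := huL 0 y z (fun i hi => by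
        obtain rfl : i = 0 := by omega
        exact hz.symm)
      have h2 := (abs_le.mp h1).2
      have h3 : (N (y.1 0) (x.1 0) : ℝ) * D ≤ NN * D :=
        mul_le_mul_of_nonneg_right (by exact_mod_cast hNle _ _) hD0
      simp only [zero_add, pow_one] at h2
      linarith
    intro x y
    have h1 := key x y
    have h2 := key y x
    rw [abs_le]; constructor <;> linarith)
  refine ⟨u, lam, _, hC.trans (le_max_left _ _), hu1, fun x => ?_⟩
  rw [← hu2, hT, Real.exp_log (tsm_pos hIrr _ x)]

/-- Normalised potential: exp f sums to one over preimages. -/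
def Norm1 (f : Shift r M → ℝ) : Prop := ∀ x, tsm f x = 1

lemma normalize_pot (hIrr : Irred M) {Λ : ℝ} (hΛ : Λ ∈ Set.Ioo (0 : ℝ) 1) (x0 : Shift r M)
    {f : Shift r M → ℝ} {K : ℝ} (hK : 0 ≤ K) (hf : ALip Λ K f) :
    ∃ (u : Shift r M → ℝ) (p K' : ℝ), 0 ≤ K' ∧ Continuous u ∧
      ALip Λ K' (fun x => f x + u x + -u (shiftMap x) + -p) ∧
      Norm1 (fun x => f x + u x + -u (shiftMap x) + -p) := by
  obtain ⟨u, p, K', hK', hu, he⟩ := eigen hIrr hΛ x0 hK hf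
  have h0 := hΛ.1
  refine ⟨u, p, _, ?_, hu.continuous hΛ, ((hf.add hu).add (hu.shift hΛ hK').neg).add
    (ALip.const Λ (-p)), fun x => ?_⟩
  · positivity
  · have h1 := he x
    have h2 : tsm (fun x => f x + u x + -u (shiftMap x) + -p) x =
        tsm (fun z => f z + u z) x * Real.exp (-(u x + p)) := by
      unfold tsm
      rw [Finset.sum_mul]
      refine Finset.sum_congr rfl fun a _ => ?_
      by_cases ha : M a (x.1 0) = true
      · simp only []
        rw [shift_pre ha, mul_assoc, ← Real.exp_add]
        congr 2; ring
      · simp [mm, ha]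
    rw [h2, h1, ← Real.exp_add]; simp


/-- weights -/
noncomputable def wt (f : Shift r M → ℝ) (a : Fin r) (x : Shift r M) : ℝ :=
  mm a x * Real.exp (f (pre a x))

/-- transfer operator -/
noncomputable def Lop (f : Shift r M → ℝ) (φ : Shift r M → ℝ) (x : Shift r M) : ℝ :=
  ∑ a, wt f a x * φ (pre a x)

lemma wt_nonneg (f : Shift r M → ℝ) (a : Fin r) (x : Shift r M) : 0 ≤ wt f a x :=
  mul_nonneg (mm_nonneg _ _) (Real.exp_pos _).le

lemma sum_wt {f : Shift r M → ℝ} (h : Norm1 f) (x : Shift r M) : ∑ a, wt f a x = 1 := h x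

lemma continuous_wt {f : Shift r M → ℝ} (hf : Continuous f) (a : Fin r) : Continuous (wt f a) :=
  (continuous_mm a).mul (Real.continuous_exp.comp (hf.comp (continuous_pre a)))

lemma continuous_Lop {f φ : Shift r M → ℝ} (hf : Continuous f) (hφ : Continuous φ) :
    Continuous (Lop f φ) :=
  continuous_finsetSum _ fun a _ => (continuous_wt hf a).mul (hφ.comp (continuous_pre a))

lemma Lop_nonneg {f φ : Shift r M → ℝ} (hφ : ∀ x, 0 ≤ φ x) (x : Shift r M) : 0 ≤ Lop f φ x :=
  Finset.sum_nonneg fun a _ => mul_nonneg (wt_nonneg _ _ _) (hφ _)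

lemma Lop_le {f φ : Shift r M → ℝ} (h : Norm1 f) {c : ℝ} (hφ : ∀ x, |φ x| ≤ c) (x : Shift r M) :
    |Lop f φ x| ≤ c := by
  calc |Lop f φ x| ≤ ∑ a, |wt f a x * φ (pre a x)| := Finset.abs_sum_le_sum_abs _ _
    _ ≤ ∑ a, wt f a x * c := by
      refine Finset.sum_le_sum fun a _ => ?_
      rw [abs_mul, abs_of_nonneg (wt_nonneg _ _ _)]
      exact mul_le_mul_of_nonneg_left (hφ _) (wt_nonneg _ _ _)
    _ = c := by rw [← Finset.sum_mul, sum_wt h, one_mul]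

lemma cont_integrable (μ : Measure (Shift r M)) [IsFiniteMeasure μ] {φ : Shift r M → ℝ}
    (hφ : Continuous φ) : Integrable φ μ :=
  hφ.integrable_of_hasCompactSupport (HasCompactSupport.of_compactSpace φ)

lemma iter_bound {f φ : Shift r M → ℝ} (h : Norm1 f) {c : ℝ} (hφ : ∀ x, |φ x| ≤ c) (k : ℕ) :
    ∀ x, |(Lop f)^[k] φ x| ≤ c := by
  induction k with
  | zero => exact hφ
  | succ k ih => rw [Function.iterate_succ_apply']; exact Lop_le h ih

lemma iter_add (f φ ψ : Shift r M → ℝ) (k : ℕ) :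
    (Lop f)^[k] (φ + ψ) = (Lop f)^[k] φ + (Lop f)^[k] ψ := by
  induction k with
  | zero => rfl
  | succ k ih =>
    simp only [Function.iterate_succ_apply', ih]
    funext x
    simp [Lop, mul_add, Finset.sum_add_distrib]

lemma iter_smul (f φ : Shift r M → ℝ) (c : ℝ) (k : ℕ) :
    (Lop f)^[k] (c • φ) = c • (Lop f)^[k] φ := by
  induction k with
  | zero => rfl
  | succ k ih =>
    simp only [Function.iterate_succ_apply', ih]
    funext x
    simp only [Lop, Pi.smul_apply, smul_eq_mul, Finset.mul_sum]
    exact Finset.sum_congr rfl fun a _ => by ring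

lemma iter_nonneg {f φ : Shift r M → ℝ} (hφ : ∀ x, 0 ≤ φ x) (k : ℕ) :
    ∀ x, 0 ≤ (Lop f)^[k] φ x := by
  induction k with
  | zero => exact hφ
  | succ k ih => rw [Function.iterate_succ_apply']; exact Lop_nonneg ih

lemma iter_one {f : Shift r M → ℝ} (h : Norm1 f) (k : ℕ) :
    (Lop f)^[k] (fun _ => 1) = fun _ => 1 := by
  induction k with
  | zero => rfl
  | succ k ih =>
    rw [Function.iterate_succ_apply', ih]; funext x; simp [Lop, sum_wt h]

/-- Cesaro averages -/
noncomputable def ces (f : Shift r M → ℝ) (x0 : Shift r M) (φ : Shift r M → ℝ) (n : ℕ) : ℝ :=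
  ((n:ℝ)+1)⁻¹ * ∑ k ∈ Finset.range (n+1), (Lop f)^[k] φ x0

lemma ces_bound {f φ : Shift r M → ℝ} (h : Norm1 f) (x0 : Shift r M) {c : ℝ}
    (hφ : ∀ x, |φ x| ≤ c) (n : ℕ) : |ces f x0 φ n| ≤ c := by
  have hn : (0:ℝ) < n + 1 := by positivity
  unfold ces
  rw [abs_mul, abs_of_pos (inv_pos.mpr hn), inv_mul_le_iff₀ hn]
  calc _ ≤ ∑ k ∈ Finset.range (n+1), |(Lop f)^[k] φ x0| := Finset.abs_sum_le_sum_abs _ _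
    _ ≤ ∑ k ∈ Finset.range (n+1), c := Finset.sum_le_sum fun k _ => iter_bound h hφ k x0
    _ = _ := by simp

lemma exists_measure {f : Shift r M → ℝ} (hf : Continuous f) (h : Norm1 f) (x0 : Shift r M) :
    ∃ μ : Measure (Shift r M), IsProbabilityMeasure μ ∧
      ∀ φ : Shift r M → ℝ, Continuous φ → ∫ x, Lop f φ x ∂μ = ∫ x, φ x ∂μ := by
  let U : Ultrafilter ℕ := Ultrafilter.of atTop
  have hU : (U : Filter ℕ) ≤ atTop := Ultrafilter.of_le _
  have hbd : ∀ φ : Shift r M → ℝ, Continuous φ → ∃ c, ∀ x, |φ x| ≤ c := fun φ hφ =>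
    ⟨‖(⟨φ, hφ⟩ : C(Shift r M, ℝ))‖, fun x => (⟨φ, hφ⟩ : C(Shift r M, ℝ)).norm_coe_le_norm x⟩
  have hex : ∀ φ : CompactlySupportedContinuousMap (Shift r M) ℝ,
      ∃ l, Tendsto (ces f x0 φ) U (𝓝 l) := by
    intro φ
    obtain ⟨c, hc⟩ := hbd φ φ.continuous
    obtain ⟨l, _, hl⟩ := (isCompact_Icc (a := -c) (b := c)).ultrafilter_le_nhds
      (U.map (ces f x0 φ)) (by
        rw [Filter.le_principal_iff]
        exact Filter.mem_map.mpr (Filter.Eventually.of_forall fun n => abs_le.mp (ces_bound h x0 hc n)))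
    exact ⟨l, hl⟩
  choose l hl using hex
  let Φ : CompactlySupportedContinuousMap (Shift r M) ℝ →ₗ[ℝ] ℝ :=
    { toFun := l
      map_add' := by
        intro φ ψ
        refine tendsto_nhds_unique (hl _) (((hl φ).add (hl ψ)).congr fun n => ?_)
        rw [CompactlySupportedContinuousMap.coe_add]
        simp [ces, iter_add, Finset.sum_add_distrib, mul_add]
      map_smul' := by
        intro c φ
        refine tendsto_nhds_unique (hl _) (((hl φ).const_mul c).congr fun n => ?_)
        rw [CompactlySupportedContinuousMap.coe_smul]
        simp only [ces, iter_smul, Pi.smul_apply, smul_eq_mul, ← Finset.mul_sum]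
        ring }
  let Ψ : CompactlySupportedContinuousMap (Shift r M) ℝ →ₚ[ℝ] ℝ := PositiveLinearMap.mk₀ Φ (by
    intro φ hφ
    refine ge_of_tendsto' (hl φ) fun n => ?_
    unfold ces
    exact mul_nonneg (by positivity) (Finset.sum_nonneg fun k _ => iter_nonneg (fun x => hφ x) k x0))
  let μ := RealRMK.rieszMeasure Ψ
  let mk : ∀ φ : Shift r M → ℝ, Continuous φ → CompactlySupportedContinuousMap (Shift r M) ℝ :=
    fun φ hφ => ⟨⟨φ, hφ⟩, HasCompactSupport.of_compactSpace φ⟩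
  have hintg : ∀ φ (hφ : Continuous φ), Tendsto (ces f x0 φ) U (𝓝 (∫ x, φ x ∂μ)) := by
    intro φ hφ
    have := RealRMK.integral_rieszMeasure Ψ (mk φ hφ)
    change ∫ x, φ x ∂μ = l (mk φ hφ) at this
    rw [this]
    exact hl (mk φ hφ)
  have hfin : IsFiniteMeasure μ := inferInstance
  refine ⟨μ, ?_, ?_⟩
  · have h1 := hintg (fun _ => 1) continuous_const
    have h2 : ces f x0 (fun _ => 1) = fun _ => 1 := by
      funext n
      have : (n:ℝ) + 1 ≠ 0 := by positivity
      simp [ces, iter_one h, this]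
    rw [h2] at h1
    have h3 := tendsto_nhds_unique h1 tendsto_const_nhds
    simp only [integral_const, smul_eq_mul, mul_one] at h3
    constructor
    rw [Measure.real, ENNReal.toReal_eq_one_iff] at h3
    exact h3
  · intro φ hφ
    have h1 := (hintg (Lop f φ) (continuous_Lop hf hφ)).sub (hintg φ hφ)
    obtain ⟨c, hc⟩ := hbd φ hφ
    have h2 : Tendsto (fun n => ces f x0 (Lop f φ) n - ces f x0 φ n) U (𝓝 0) := by
      have h3 : Tendsto (fun n : ℕ => (2 * c) * (1 / ((n:ℝ) + 1))) U (𝓝 0) := by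
        have := (tendsto_one_div_add_atTop_nhds_zero_nat (𝕜 := ℝ)).const_mul (2*c)
        rw [mul_zero] at this
        exact this.mono_left hU
      refine squeeze_zero_norm (fun n => ?_) h3
      have hn : (0:ℝ) < n + 1 := by positivity
      have h4 : ces f x0 (Lop f φ) n - ces f x0 φ n =
          ((n:ℝ)+1)⁻¹ * ((Lop f)^[n+1] φ x0 - φ x0) := by
        unfold ces
        rw [← mul_sub, ← Finset.sum_sub_distrib]
        congr 1
        have := Finset.sum_range_sub (fun k => (Lop f)^[k] φ x0) (n+1)
        simpa [Function.iterate_succ_apply] using this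
      rw [h4, norm_mul, Real.norm_eq_abs, Real.norm_eq_abs, abs_of_pos (inv_pos.mpr hn), one_div,
        mul_comm (2*c)]
      refine mul_le_mul_of_nonneg_left ?_ (by positivity)
      have h5 := abs_le.mp (iter_bound h hc (n+1) x0)
      have h6 := abs_le.mp (hc x0)
      rw [abs_le]; constructor <;> linarith [h5.1, h5.2, h6.1, h6.2]
    have := tendsto_nhds_unique h1 h2
    linarith

lemma Lop_comp_shift {f : Shift r M → ℝ} (φ ψ : Shift r M → ℝ) (x : Shift r M) :
    Lop f (fun z => φ z * ψ (shiftMap z)) x = Lop f φ x * ψ x := by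
  unfold Lop
  rw [Finset.sum_mul]
  refine Finset.sum_congr rfl fun a _ => ?_
  by_cases ha : M a (x.1 0) = true
  · simp only []
    rw [shift_pre ha]; ring
  · simp [wt, mm, ha]

lemma Lop_one {f : Shift r M → ℝ} (h : Norm1 f) (x : Shift r M) : Lop f (fun _ => 1) x = 1 := by
  simp [Lop, sum_wt h]

lemma inv_of_Lop {f : Shift r M → ℝ} (h : Norm1 f) {μ : Measure (Shift r M)}
    [IsProbabilityMeasure μ]
    (hμ : ∀ φ : Shift r M → ℝ, Continuous φ → ∫ x, Lop f φ x ∂μ = ∫ x, φ x ∂μ) : InvProb μ := by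
  refine ⟨inferInstance, ?_⟩
  have hm : Measurable (shiftMap : Shift r M → Shift r M) := continuous_shiftMap.measurable
  have : IsProbabilityMeasure (μ.map shiftMap) := Measure.isProbabilityMeasure_map hm.aemeasurable
  apply ext_of_forall_integral_eq_of_IsFiniteMeasure
  intro φ
  rw [integral_map hm.aemeasurable φ.continuous.aestronglyMeasurable]
  rw [← hμ (fun x => φ (shiftMap x)) (φ.continuous.comp continuous_shiftMap)]
  refine integral_congr_ae (Eventually.of_forall fun x => ?_)
  have := Lop_comp_shift (f := f) (fun _ => 1) φ x
  simpa [Lop_one h] using this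

lemma full_support (hIrr : Irred M) {Λ : ℝ} (hΛ : Λ ∈ Set.Ioo (0 : ℝ) 1)
    {f : Shift r M → ℝ} (hf : Continuous f) {μ : Measure (Shift r M)}
    [IsProbabilityMeasure μ]
    (hμ : ∀ φ : Shift r M → ℝ, Continuous φ → ∫ x, Lop f φ x ∂μ = ∫ x, φ x ∂μ)
    {φ : Shift r M → ℝ} {K : ℝ} (hφ : ALip Λ K φ) (h0 : ∀ x, 0 ≤ φ x)
    (hintg : ∫ x, φ x ∂μ = 0) : ∀ x, φ x = 0 := by
  by_contra hcon
  push Not at hcon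
  obtain ⟨y, hy⟩ := hcon
  have hy : 0 < φ y := lt_of_le_of_ne (h0 y) hy.symm
  have hφc := hφ.continuous hΛ
  have hc : ∀ k, Continuous ((Lop f)^[k] φ) := by
    intro k
    induction k with
    | zero => exact hφc
    | succ k ih => rw [Function.iterate_succ_apply']; exact continuous_Lop hf ih
  have hz : ∀ k, ∫ x, (Lop f)^[k] φ x ∂μ = 0 := by
    intro k
    induction k with
    | zero => exact hintg
    | succ k ih => rw [Function.iterate_succ_apply', hμ _ (hc k)]; exact ih
  have hae : ∀ᵐ x ∂μ, ∀ k, (Lop f)^[k] φ x = 0 := by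
    rw [ae_all_iff]
    intro k
    have := (integral_eq_zero_iff_of_nonneg (fun x => iter_nonneg h0 k x)
      (cont_integrable μ (hc k))).mp (hz k)
    exact this
  obtain ⟨x, hx⟩ := hae.exists
  obtain ⟨n, hn⟩ := exists_small hΛ K hy
  obtain ⟨k, z, hz1, hz2⟩ := reach_point hIrr (y.1 n) x
  obtain ⟨z', hz3, hz4⟩ := splice y n z hz1
  have hpos : 0 < φ z' := by
    have := (abs_le.mp (hφ n z' y (fun i hi => hz3 i (by omega)))).1
    linarith
  have key : ∀ (k : ℕ), 0 < (Lop f)^[k] φ (shiftMap^[k] z') := by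
    intro k
    induction k with
    | zero => exact hpos
    | succ k ih =>
      rw [Function.iterate_succ_apply', Function.iterate_succ_apply']
      set w := shiftMap^[k] z' with hw
      have hM : M (w.1 0) ((shiftMap w).1 0) = true := w.2 0
      refine Finset.sum_pos' (fun a _ => mul_nonneg (wt_nonneg _ _ _) (iter_nonneg h0 k _))
        ⟨w.1 0, Finset.mem_univ _, ?_⟩
      rw [pre_shift]
      refine mul_pos ?_ ih
      unfold wt mm
      rw [if_pos hM, one_mul]
      exact Real.exp_pos _
  have h1 := key (k + n)
  rw [Function.iterate_add_apply shiftMap, hz4, hz2, hx] at h1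
  exact lt_irrefl _ h1


/-- conditional probability of a word given the future -/
noncomputable def J (f : Shift r M → ℝ) : (n : ℕ) → (Fin n → Fin r) → Shift r M → ℝ
  | 0, _, _ => 1
  | n+1, w, x => wt f (w (Fin.last n)) x *
      J f n (fun i => w i.castSucc) (pre (w (Fin.last n)) x)

lemma J_nonneg (f : Shift r M → ℝ) : ∀ (n : ℕ) (w : Fin n → Fin r) (x : Shift r M), 0 ≤ J f n w x
  | 0, _, _ => zero_le_one
  | n+1, _, _ => mul_nonneg (wt_nonneg _ _ _) (J_nonneg f n _ _)

lemma continuous_J {f : Shift r M → ℝ} (hf : Continuous f) :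
    ∀ (n : ℕ) (w : Fin n → Fin r), Continuous (J f n w)
  | 0, _ => continuous_const
  | n+1, w => (continuous_wt hf _).mul
      ((continuous_J hf n (fun i => w i.castSucc)).comp (continuous_pre _))

lemma sum_words {n : ℕ} (F : (Fin (n+1) → Fin r) → ℝ) :
    ∑ w, F w = ∑ b : Fin r, ∑ w : Fin n → Fin r, F (Fin.snoc (α := fun _ => Fin r) w b) := by
  rw [← (Fin.snocEquiv (fun _ : Fin (n+1) => Fin r)).sum_comp, Fintype.sum_prod_type]
  rfl

lemma J_snoc (f : Shift r M → ℝ) (n : ℕ) (w : Fin n → Fin r) (b : Fin r) (x : Shift r M) :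
    J f (n+1) (Fin.snoc (α := fun _ => Fin r) w b) x = wt f b x * J f n w (pre b x) := by
  simp [J]

lemma sum_J {f : Shift r M → ℝ} (h : Norm1 f) (n : ℕ) : ∀ x, ∑ w, J f n w x = 1 := by
  induction n with
  | zero => intro x; simp [J]
  | succ n ih =>
    intro x
    rw [sum_words]
    simp only [J_snoc, ← Finset.mul_sum, ih, mul_one]
    exact sum_wt h x

lemma negMulLog_wt (f : Shift r M → ℝ) (b : Fin r) (x : Shift r M) :
    Real.negMulLog (wt f b x) = wt f b x * -f (pre b x) := by
  unfold wt mm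
  split_ifs
  · simp [Real.negMulLog]
  · simp

lemma ent_J_succ {f : Shift r M → ℝ} (h : Norm1 f) (n : ℕ) (x : Shift r M) :
    ∑ w, Real.negMulLog (J f (n+1) w x) =
      Lop f (fun z => -f z + ∑ w, Real.negMulLog (J f n w z)) x := by
  rw [sum_words]
  unfold Lop
  refine Finset.sum_congr rfl fun b _ => ?_
  simp only [J_snoc, Real.negMulLog_mul, Finset.sum_add_distrib, ← Finset.mul_sum,
    ← Finset.sum_mul, sum_J h, one_mul, negMulLog_wt]
  ring

lemma continuous_entJ {f : Shift r M → ℝ} (hf : Continuous f) (n : ℕ) :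
    Continuous (fun z => ∑ w, Real.negMulLog (J f n w z)) :=
  continuous_finsetSum _ fun w _ => Real.continuous_negMulLog.comp (continuous_J hf n w)

lemma integral_entJ {f : Shift r M → ℝ} (hf : Continuous f) (h : Norm1 f)
    {μ : Measure (Shift r M)} [IsProbabilityMeasure μ]
    (hμ : ∀ φ : Shift r M → ℝ, Continuous φ → ∫ x, Lop f φ x ∂μ = ∫ x, φ x ∂μ) (n : ℕ) :
    ∫ x, ∑ w, Real.negMulLog (J f n w x) ∂μ = n * -∫ x, f x ∂μ := by
  induction n with
  | zero => simp [J]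
  | succ n ih =>
    simp only [ent_J_succ h]
    have hn : Continuous (fun z => -f z) := hf.neg
    have hc : Continuous (fun z => -f z + ∑ w, Real.negMulLog (J f n w z)) :=
      hn.add (continuous_entJ hf n)
    rw [hμ _ hc, integral_add (cont_integrable μ hn)
      (cont_integrable μ (continuous_entJ hf n)), ih, integral_neg]
    push_cast; ring

/-- cylinder indicator -/
noncomputable def cind (n : ℕ) (w : Fin n → Fin r) (x : Shift r M) : ℝ :=
  if (∀ i : Fin n, x.1 i.1 = w i) then 1 else 0

lemma continuous_cind (n : ℕ) (w : Fin n → Fin r) :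
    Continuous (cind n w : Shift r M → ℝ) := by
  have h : Continuous (fun v : Fin n → Fin r => if (∀ i : Fin n, v i = w i) then (1:ℝ) else 0) :=
    continuous_of_discreteTopology
  have h2 : Continuous (fun x : Shift r M => fun i : Fin n => x.1 i.1) :=
    continuous_pi fun i => continuous_coord i.1
  exact h.comp h2

lemma integral_cind (μ : Measure (Shift r M)) (n : ℕ) (w : Fin n → Fin r) :
    ∫ x, cind n w x ∂μ = (μ {x : Shift r M | ∀ i : Fin n, x.1 i.1 = w i}).toReal := by
  have hm : MeasurableSet {x : Shift r M | ∀ i : Fin n, x.1 i.1 = w i} := by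
    have : {x : Shift r M | ∀ i : Fin n, x.1 i.1 = w i} = cind n w ⁻¹' {1} := by
      ext x; simp [cind]
    rw [this]
    exact (continuous_cind n w).measurable (measurableSet_singleton 1)
  have h2 : (cind n w : Shift r M → ℝ) =
      Set.indicator {x : Shift r M | ∀ i : Fin n, x.1 i.1 = w i} 1 := by
    funext x
    simp [cind, Set.indicator_apply]
  rw [h2, integral_indicator_one hm]; rfl

lemma cind_succ (n : ℕ) (w : Fin (n+1) → Fin r) (x : Shift r M) :
    cind (n+1) w x = cind n (fun i => w i.castSucc) x *
      (if (shiftMap^[n] x).1 0 = w (Fin.last n) then 1 else 0) := by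
  rw [iterate_shift_coord]
  simp only [cind, Fin.forall_fin_succ', Fin.val_castSucc, Fin.val_last, add_zero]
  by_cases h1 : ∀ i : Fin n, x.1 i = w i.castSucc <;> by_cases h2 : x.1 n = w (Fin.last n) <;>
    simp [h1, h2]

lemma integral_J {f : Shift r M → ℝ} (hf : Continuous f)
    {μ : Measure (Shift r M)}
    (hμ : ∀ φ : Shift r M → ℝ, Continuous φ → ∫ x, Lop f φ x ∂μ = ∫ x, φ x ∂μ) (n : ℕ) :
    ∀ (w : Fin n → Fin r) (ψ : Shift r M → ℝ), Continuous ψ →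
    ∫ x, cind n w x * ψ (shiftMap^[n] x) ∂μ = ∫ x, J f n w x * ψ x ∂μ := by
  induction n with
  | zero => intro w ψ _; simp [cind, J]
  | succ n ih =>
    intro w ψ hψ
    set b := w (Fin.last n) with hb
    set w' : Fin n → Fin r := fun i => w i.castSucc with hw'
    let ib : Shift r M → ℝ := fun z => if z.1 0 = b then 1 else 0
    have hib : Continuous ib := by
      have h : Continuous (fun c : Fin r => if c = b then (1:ℝ) else 0) :=
        continuous_of_discreteTopology
      exact h.comp (continuous_coord 0)
    have h1 : ∀ x : Shift r M, cind (n+1) w x * ψ (shiftMap^[n+1] x) =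
        cind n w' x * (fun z => ib z * ψ (shiftMap z)) (shiftMap^[n] x) := by
      intro x
      rw [cind_succ, Function.iterate_succ_apply']
      ring
    have hJc := continuous_J hf n w'
    have h2 : ∀ x, Lop f (fun z => J f n w' z * ib z) x = J f (n+1) w x := by
      intro x
      unfold Lop
      rw [Finset.sum_eq_single b]
      · by_cases hM : M b (x.1 0) = true
        · simp only [ib, pre_zero hM, if_true, mul_one]; rfl
        · have : wt f b x = 0 := by simp [wt, mm, hM]
          simp [J, ← hb, this]
      · intro a _ ha
        by_cases hM : M a (x.1 0) = true
        · simp [ib, pre_zero hM, ha]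
        · simp [wt, mm, hM]
      · simp
    have hc : Continuous (fun z => ib z * ψ (shiftMap z)) :=
      hib.mul (hψ.comp continuous_shiftMap)
    rw [integral_congr_ae (Eventually.of_forall h1), ih w' (fun z => ib z * ψ (shiftMap z)) hc]
    have h3 := hμ (fun z => (J f n w' z * ib z) * ψ (shiftMap z))
      ((hJc.mul hib).mul (hψ.comp continuous_shiftMap))
    simp only [Lop_comp_shift (f := f) (fun z => J f n w' z * ib z) ψ, h2] at h3
    rw [h3]
    simp only [mul_assoc]

lemma cylEnt_lower {f : Shift r M → ℝ} (hf : Continuous f) (h : Norm1 f)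
    {μ : Measure (Shift r M)} [IsProbabilityMeasure μ]
    (hμ : ∀ φ : Shift r M → ℝ, Continuous φ → ∫ x, Lop f φ x ∂μ = ∫ x, φ x ∂μ) (n : ℕ) :
    n * -∫ x, f x ∂μ ≤ cylEnt μ n := by
  have hc : ∀ w, Continuous (fun x => Real.negMulLog (J f n w x)) := fun w =>
    Real.continuous_negMulLog.comp (continuous_J hf n w)
  rw [← integral_entJ hf h hμ n, integral_finsetSum _ fun w _ => cont_integrable μ (hc w)]
  unfold cylEnt
  refine Finset.sum_le_sum fun w _ => ?_
  have h1 := integral_J hf hμ n w (fun _ => 1) continuous_const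
  simp only [mul_one] at h1
  rw [← integral_cind, h1]
  exact Real.concaveOn_negMulLog.le_map_integral Real.continuous_negMulLog.continuousOn
    isClosed_Ici (Eventually.of_forall fun x => J_nonneg f n w x)
    (cont_integrable μ (continuous_J hf n w))
    (cont_integrable μ (Real.continuous_negMulLog.comp (continuous_J hf n w)))

lemma cylEnt_nonneg (μ : Measure (Shift r M)) [IsProbabilityMeasure μ] (n : ℕ) :
    0 ≤ cylEnt μ n :=
  Finset.sum_nonneg fun _ _ => Real.negMulLog_nonneg ENNReal.toReal_nonneg
    measureReal_le_one

lemma entropy_bdd (μ : Measure (Shift r M)) [IsProbabilityMeasure μ] :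
    BddBelow (Set.range fun n : ℕ => cylEnt μ (n + 1) / ((n:ℝ) + 1)) :=
  ⟨0, by rintro _ ⟨n, rfl⟩; exact div_nonneg (cylEnt_nonneg μ _) (by positivity)⟩

lemma entropy_lower {f : Shift r M → ℝ} (hf : Continuous f) (h : Norm1 f)
    {μ : Measure (Shift r M)} [IsProbabilityMeasure μ]
    (hμ : ∀ φ : Shift r M → ℝ, Continuous φ → ∫ x, Lop f φ x ∂μ = ∫ x, φ x ∂μ) :
    -∫ x, f x ∂μ ≤ entropy μ := by
  refine le_ciInf fun n => ?_
  have := cylEnt_lower hf h hμ (n+1)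
  rw [le_div_iff₀ (by positivity)]
  push_cast at this
  linarith

lemma J_lower {Λ : ℝ} (hΛ : Λ ∈ Set.Ioo (0 : ℝ) 1) {f : Shift r M → ℝ} {K : ℝ}
    (hf : ALip Λ K f) (n : ℕ) : ∀ (k : ℕ) (y x : Shift r M), Agree (k+1) x (shiftMap^[n] y) →
      Real.exp (∑ j ∈ Finset.range n, f (shiftMap^[j] y) - K * Λ^(k+2) / (1 - Λ)) ≤
        J f n (fun i => y.1 i) x ∨ K < 0 := by
  have h1Λ : 0 < 1 - Λ := by linarith [hΛ.2]
  have hΛ0 := hΛ.1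
  by_cases hK : K < 0
  · intros; exact Or.inr hK
  push Not at hK
  induction n with
  | zero =>
    intro k y x _
    left
    simp only [Finset.range_zero, Finset.sum_empty, zero_sub, J]
    rw [Real.exp_le_one_iff, neg_nonpos]
    positivity
  | succ n ih =>
    intro k y x hxy
    left
    have hb : (shiftMap^[n] y).1 0 = y.1 n := by rw [iterate_shift_coord, add_zero]
    have hx0 : x.1 0 = y.1 (n+1) := by
      rw [hxy 0 (by omega), iterate_shift_coord, add_zero]
    have hM : M (y.1 n) (x.1 0) = true := by rw [hx0]; exact y.2 n
    rw [Function.iterate_succ_apply'] at hxy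
    have hM' : M (y.1 n) ((shiftMap (shiftMap^[n] y)).1 0) = true := by
      rw [← hxy 0 (by omega)]; exact hM
    have hag := pre_agree hM hM' hxy
    rw [← hb, pre_shift, hb] at hag
    have h1 := (ih (k+1) y _ hag).resolve_right (not_lt.mpr hK)
    have h2 := (abs_le.mp (hf _ _ _ hag)).1
    have h3 : J f (n+1) (fun i => y.1 i) x =
        Real.exp (f (pre (y.1 n) x)) * J f n (fun i => y.1 i) (pre (y.1 n) x) := by
      simp only [J, wt, mm, Fin.val_last, hM, if_true, one_mul, Fin.val_castSucc]
    rw [h3, Finset.sum_range_succ]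
    refine le_trans ?_ (mul_le_mul_of_nonneg_left h1 (Real.exp_pos _).le)
    rw [← Real.exp_add, Real.exp_le_exp]
    have h4 : K * Λ^(k+2) / (1-Λ) = K * Λ^(k+1+1) + K * Λ^(k+1+2)/(1-Λ) := by
      field_simp; ring
    rw [h4]
    linarith

lemma integral_iter_shift {ν : Measure (Shift r M)} (hν : InvProb ν) {φ : Shift r M → ℝ}
    (hφ : Continuous φ) (n : ℕ) : ∫ x, φ (shiftMap^[n] x) ∂ν = ∫ x, φ x ∂ν := by
  induction n with
  | zero => rfl
  | succ n ih =>
    rw [← ih]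
    have hc : Continuous (fun x : Shift r M => φ (shiftMap^[n] x)) :=
      hφ.comp (continuous_shiftMap.iterate n)
    have := integral_map (μ := ν) (φ := shiftMap) continuous_shiftMap.measurable.aemeasurable
      (f := fun x => φ (shiftMap^[n] x)) hc.aestronglyMeasurable
    rw [hν.2] at this
    rw [this]
    rfl

lemma cylEnt_upper (hIrr : Irred M) {Λ : ℝ} (hΛ : Λ ∈ Set.Ioo (0 : ℝ) 1) (x0 : Shift r M)
    {f : Shift r M → ℝ} {K : ℝ} (hK : 0 ≤ K)
    (hf : ALip Λ K f) (h : Norm1 f) {ν : Measure (Shift r M)} (hν : InvProb ν) (n : ℕ) :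
    cylEnt ν n + n * ∫ x, f x ∂ν ≤ K * Λ^2 / (1 - Λ) + Real.log r := by
  have hprob := hν.1
  have hfc := hf.continuous hΛ
  choose xb hxb using exists_point hIrr
  have hr : (0:ℝ) < r := by
    have := (x0.1 0).pos
    exact_mod_cast this
  set C := K * Λ^2 / (1 - Λ) with hC
  let q : (Fin n → Fin r) → ℝ := fun w => (r:ℝ)⁻¹ * ∑ b, J f n w (xb b)
  have hq0 : ∀ w, 0 ≤ q w := fun w =>
    mul_nonneg (by positivity) (Finset.sum_nonneg fun b _ => J_nonneg f n w _)
  have hq1 : ∑ w, q w = 1 := by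
    simp only [q, ← Finset.mul_sum]
    rw [Finset.sum_comm]
    simp only [sum_J h]
    simp [hr.ne']
  have hlow : ∀ y : Shift r M, (r:ℝ)⁻¹ * Real.exp (∑ j ∈ Finset.range n, f (shiftMap^[j] y) - C) ≤
      q (fun i => y.1 i) := by
    intro y
    have h1 := (J_lower hΛ hf n 0 y (xb ((shiftMap^[n] y).1 0)) (fun i hi => by
      obtain rfl : i = 0 := by omega
      exact hxb _)).resolve_right (not_lt.mpr hK)
    refine mul_le_mul_of_nonneg_left (h1.trans ?_) (by positivity)
    exact Finset.single_le_sum (f := fun b => J f n (fun i => y.1 i) (xb b))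
      (fun b _ => J_nonneg f n _ _) (Finset.mem_univ _)
  have hqpos : ∀ y : Shift r M, 0 < q (fun i => y.1 i) := fun y =>
    lt_of_lt_of_le (by positivity) (hlow y)
  have hS : ∀ y : Shift r M, ∑ j ∈ Finset.range n, f (shiftMap^[j] y) ≤
      (C + Real.log r) + ∑ w, cind n w y * Real.log (q w) := by
    intro y
    have h1 : ∑ w, cind n w y * Real.log (q w) = Real.log (q (fun i => y.1 i)) := by
      rw [Finset.sum_eq_single (fun i : Fin n => y.1 i)]
      · simp [cind]
      · intro w _ hw
        have : ¬ ∀ i : Fin n, y.1 i.1 = w i := fun hc => hw (funext fun i => (hc i).symm)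
        simp [cind, this]
      · simp
    rw [h1]
    have h2 := Real.log_le_log (by positivity) (hlow y)
    rw [Real.log_mul (by positivity) (Real.exp_pos _).ne', Real.log_exp, Real.log_inv] at h2
    linarith
  have hintg : (n:ℝ) * ∫ x, f x ∂ν ≤ (C + Real.log r) +
      ∑ w : Fin n → Fin r, (∫ x, cind n w x ∂ν) * Real.log (q w) := by
    have hc1 : ∀ j, Continuous (fun y : Shift r M => f (shiftMap^[j] y)) := fun j =>
      hfc.comp (continuous_shiftMap.iterate j)
    have hc2 : ∀ w, Continuous (fun y : Shift r M => cind n w y * Real.log (q w)) := fun w =>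
      (continuous_cind n w).mul continuous_const
    have hc3 : Continuous (fun y : Shift r M => ∑ w, cind n w y * Real.log (q w)) :=
      continuous_finsetSum _ fun w _ => hc2 w
    have hc4 : Continuous (fun y : Shift r M =>
        (C + Real.log r) + ∑ w, cind n w y * Real.log (q w)) := continuous_const.add hc3
    have hc5 : Continuous (fun y : Shift r M => ∑ j ∈ Finset.range n, f (shiftMap^[j] y)) :=
      continuous_finsetSum (Finset.range n) fun j _ => hc1 j
    have h1 := integral_mono (μ := ν) (cont_integrable ν hc5) (cont_integrable ν hc4) hS
    rw [integral_finsetSum _ fun j _ => cont_integrable ν (hc1 j),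
      integral_add (integrable_const _) (cont_integrable ν hc3),
      integral_finsetSum _ fun w _ => cont_integrable ν (hc2 w)] at h1
    simp only [integral_iter_shift hν hfc, integral_mul_const] at h1
    simpa using h1
  have hG : cylEnt ν n + ∑ w : Fin n → Fin r, (∫ x, cind n w x ∂ν) * Real.log (q w) ≤ 0 := by
    have hp1 : ∑ w : Fin n → Fin r, (∫ x, cind n w x ∂ν) = 1 := by
      rw [← integral_finsetSum _ fun w _ => cont_integrable ν (continuous_cind n w)]
      have : ∀ y : Shift r M, ∑ w, cind n w y = 1 := by
        intro y
        rw [Finset.sum_eq_single (fun i : Fin n => y.1 i)]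
        · simp [cind]
        · intro w _ hw
          have : ¬ ∀ i : Fin n, y.1 i.1 = w i := fun hc => hw (funext fun i => (hc i).symm)
          simp [cind, this]
        · simp
      simp [this]
    unfold cylEnt
    rw [← Finset.sum_add_distrib]
    have : ∑ w : Fin n → Fin r, (q w - ∫ x, cind n w x ∂ν) = 0 := by
      rw [Finset.sum_sub_distrib, hq1, hp1, sub_self]
    rw [← this]
    refine Finset.sum_le_sum fun w _ => ?_
    rw [integral_cind]
    set p := (ν {x : Shift r M | ∀ i : Fin n, x.1 i.1 = w i}).toReal with hp
    have hp0 : 0 ≤ p := ENNReal.toReal_nonneg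
    rcases hp0.eq_or_lt with h0 | hpos
    · rw [← h0]; simpa using hq0 w
    · have hne : {x : Shift r M | ∀ i : Fin n, x.1 i.1 = w i}.Nonempty := by
        rw [Set.nonempty_iff_ne_empty]
        intro he
        rw [hp, he] at hpos
        simp at hpos
      obtain ⟨y, hy⟩ := hne
      have hwy : w = fun i : Fin n => y.1 i := funext fun i => (hy i).symm
      have hqp : 0 < q w := by rw [hwy]; exact hqpos y
      have h1 := Real.log_le_sub_one_of_pos (div_pos hqp hpos)
      rw [Real.log_div hqp.ne' hpos.ne'] at h1
      have h2 := mul_le_mul_of_nonneg_left h1 hpos.le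
      have h3 : p * (q w / p - 1) = q w - p := by field_simp
      rw [h3] at h2
      unfold Real.negMulLog
      linarith
  linarith

lemma entropy_upper (hIrr : Irred M) {Λ : ℝ} (hΛ : Λ ∈ Set.Ioo (0 : ℝ) 1) (x0 : Shift r M)
    {f : Shift r M → ℝ} {K : ℝ} (hK : 0 ≤ K)
    (hf : ALip Λ K f) (h : Norm1 f) {ν : Measure (Shift r M)} (hν : InvProb ν) :
    entropy ν + ∫ x, f x ∂ν ≤ 0 := by
  have hprob := hν.1
  have h1 : ∀ n : ℕ, entropy ν + ∫ x, f x ∂ν ≤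
      (K * Λ^2 / (1 - Λ) + Real.log r) * (1 / ((n:ℝ) + 1)) := by
    intro n
    have hn : (0:ℝ) < n + 1 := by positivity
    have h2 : entropy ν ≤ cylEnt ν (n+1) / ((n:ℝ)+1) := ciInf_le (entropy_bdd ν) n
    have h3 := cylEnt_upper hIrr hΛ x0 hK hf h hν (n+1)
    rw [mul_one_div, le_div_iff₀ hn]
    rw [le_div_iff₀ hn] at h2
    push_cast at h3
    linarith
  have h4 := (tendsto_one_div_add_atTop_nhds_zero_nat (𝕜 := ℝ)).const_mul
    (K * Λ^2 / (1 - Λ) + Real.log r)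
  rw [mul_zero] at h4
  exact ge_of_tendsto' h4 h1


lemma exists_equilibrium (hIrr : Irred M) {Λ : ℝ} (hΛ : Λ ∈ Set.Ioo (0 : ℝ) 1) (x0 : Shift r M)
    {f : Shift r M → ℝ} {K : ℝ} (hK : 0 ≤ K) (hf : ALip Λ K f) :
    ∃ μ : Measure (Shift r M), InvProb μ ∧
      (∀ (φ : Shift r M → ℝ) (K' : ℝ), ALip Λ K' φ → (∀ x, 0 ≤ φ x) → ∫ x, φ x ∂μ = 0 →
        ∀ x, φ x = 0) ∧
      ∀ ν : Measure (Shift r M), InvProb ν →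
        ∫ x, f x ∂ν + entropy ν ≤ ∫ x, f x ∂μ + entropy μ := by
  obtain ⟨u, p, K', hK', hu, hl, hn⟩ := normalize_pot hIrr hΛ x0 hK hf
  have hfc := hf.continuous hΛ
  have hgc := hl.continuous hΛ
  obtain ⟨μ, hprob, hμ⟩ := exists_measure hgc hn x0
  have hinv : InvProb μ := inv_of_Lop hn hμ
  have hintg : ∀ ν : Measure (Shift r M), InvProb ν →
      ∫ x, (f x + u x + -u (shiftMap x) + -p) ∂ν = ∫ x, f x ∂ν - p := by
    intro ν hν
    have := hν.1
    have hus : Continuous (fun x : Shift r M => -u (shiftMap x)) :=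
      (hu.comp continuous_shiftMap).neg
    have h1 := integral_iter_shift hν hu 1
    simp only [Function.iterate_one] at h1
    have i1 := cont_integrable ν hfc
    have i2 := cont_integrable ν hu
    have i3 := cont_integrable ν hus
    have e1 : ∫ x, (f x + u x + -u (shiftMap x) + -p) ∂ν =
        ∫ x, (f x + u x + -u (shiftMap x)) ∂ν + ∫ _x, -p ∂ν :=
      integral_add ((i1.add i2).add i3) (integrable_const _)
    have e2 : ∫ x, (f x + u x + -u (shiftMap x)) ∂ν =
        ∫ x, (f x + u x) ∂ν + ∫ x, -u (shiftMap x) ∂ν :=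
      integral_add (i1.add i2) i3
    have e3 : ∫ x, (f x + u x) ∂ν = ∫ x, f x ∂ν + ∫ x, u x ∂ν := integral_add i1 i2
    have e4 : ∫ _x : Shift r M, -p ∂ν = -p := by simp
    rw [e1, e2, e3, e4, integral_neg, h1]
    ring
  refine ⟨μ, hinv, fun φ K'' hφ h0 hi => full_support hIrr hΛ hgc hμ hφ h0 hi, fun ν hν => ?_⟩
  have h1 := entropy_upper hIrr hΛ x0 hK' hl hn hν
  have h2 := entropy_lower hgc hn hμ
  rw [hintg ν hν] at h1
  rw [hintg μ hinv] at h2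
  linarith

lemma entropy_le_card (ν : Measure (Shift r M)) [IsProbabilityMeasure ν] :
    entropy ν ≤ ∑ _w : Fin 1 → Fin r, (1:ℝ) := by
  have h2 : entropy ν ≤ cylEnt ν (0+1) / (((0:ℕ):ℝ)+1) := ciInf_le (entropy_bdd ν) 0
  refine h2.trans ?_
  simp only [Nat.cast_zero, zero_add, div_one]
  refine Finset.sum_le_sum fun w _ => ?_
  have h3 : ∀ t : ℝ, 0 ≤ t → Real.negMulLog t ≤ 1 := by
    intro t ht
    rcases ht.eq_or_lt with h0 | hpos
    · rw [← h0]; simp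
    · have h4 := Real.log_le_sub_one_of_pos (inv_pos.mpr hpos)
      rw [Real.log_inv] at h4
      have h5 := mul_le_mul_of_nonneg_left h4 hpos.le
      have h6 : t * (t⁻¹ - 1) = 1 - t := by field_simp
      rw [h6] at h5
      unfold Real.negMulLog
      linarith
  exact h3 _ ENNReal.toReal_nonneg

lemma Gset_bdd {g : Shift r M → ℝ} (hg : Continuous g) :
    BddAbove {t : ℝ | ∃ μ : Measure (Shift r M), InvProb μ ∧ t = ∫ x, g x ∂μ + entropy μ} := by
  refine ⟨‖(⟨g, hg⟩ : C(Shift r M, ℝ))‖ + ∑ _w : Fin 1 → Fin r, (1:ℝ), ?_⟩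
  rintro _ ⟨μ, hμ, rfl⟩
  have := hμ.1
  refine add_le_add ?_ (entropy_le_card μ)
  have h1 : ∫ x, g x ∂μ ≤ ∫ _x, ‖(⟨g, hg⟩ : C(Shift r M, ℝ))‖ ∂μ :=
    integral_mono (cont_integrable μ hg) (integrable_const _) fun x =>
      (le_abs_self _).trans ((⟨g, hg⟩ : C(Shift r M, ℝ)).norm_coe_le_norm x)
  simpa using h1

lemma le_Gplus {A : Shift r M → Shift r M → ℝ} (hA : ∀ y, Continuous (A y))
    {φ : Shift r M → ℝ} (hφ : Continuous φ) (y : Shift r M) {μ : Measure (Shift r M)}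
    (hμ : InvProb μ) : ∫ x, (A y x + φ x) ∂μ + entropy μ ≤ Gplus A φ y :=
  le_csSup (Gset_bdd (g := fun x => A y x + φ x) ((hA y).add hφ)) ⟨μ, hμ, rfl⟩

/-- monotone comparison of the operator at two points -/
lemma Gplus_le_add (hne : ∃ μ : Measure (Shift r M), InvProb μ)
    {A : Shift r M → Shift r M → ℝ} (hA : ∀ y, Continuous (A y))
    {φ ψ : Shift r M → ℝ} (hφ : Continuous φ) (hψ : Continuous ψ) {y z : Shift r M} {c : ℝ}
    (h : ∀ x, A y x + φ x ≤ (A z x + ψ x) + c) : Gplus A φ y ≤ Gplus A ψ z + c := by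
  refine csSup_le ?_ ?_
  · obtain ⟨μ, hμ⟩ := hne
    exact ⟨_, μ, hμ, rfl⟩
  · rintro _ ⟨μ, hμ, rfl⟩
    have := hμ.1
    have hc1 : Continuous (fun x => A y x + φ x) := (hA y).add hφ
    have hc2 : Continuous (fun x => A z x + ψ x) := (hA z).add hψ
    have h1 : ∫ x, (A y x + φ x) ∂μ ≤ ∫ x, ((A z x + ψ x) + c) ∂μ :=
      integral_mono (cont_integrable μ hc1)
      ((cont_integrable μ hc2).add (integrable_const c)) h
    have h2 : ∫ x, ((A z x + ψ x) + c) ∂μ =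
        ∫ x, (A z x + ψ x) ∂μ + ∫ _x, c ∂μ :=
      integral_add (cont_integrable μ hc2) (integrable_const c)
    have h4 : ∫ _x : Shift r M, c ∂μ = c := by simp
    rw [h2, h4] at h1
    have h3 := le_Gplus hA hψ z hμ
    linarith

lemma Gplus_alip (hne : ∃ μ : Measure (Shift r M), InvProb μ) {Λ K : ℝ}
    {A : Shift r M → Shift r M → ℝ} (hA : ∀ y, Continuous (A y))
    (hA2 : ∀ n y y' x, Agree n y y' → |A y x - A y' x| ≤ K * Λ ^ n)
    {φ : Shift r M → ℝ} (hφ : Continuous φ) : ALip Λ K (Gplus A φ) := by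
  intro n y y' hy
  have h1 : Gplus A φ y ≤ Gplus A φ y' + K * Λ^n := Gplus_le_add hne hA hφ hφ fun x => by
    have := (abs_le.mp (hA2 n y y' x hy)).2
    linarith
  have h2 : Gplus A φ y' ≤ Gplus A φ y + K * Λ^n := Gplus_le_add hne hA hφ hφ fun x => by
    have := (abs_le.mp (hA2 n y y' x hy)).1
    linarith
  rw [abs_le]
  constructor <;> linarith

lemma exists_effective (hIrr : Irred M) {Λ : ℝ} (hΛ : Λ ∈ Set.Ioo (0 : ℝ) 1) (x0 : Shift r M)
    {A : Shift r M → Shift r M → ℝ} {K : ℝ} (hK : 0 ≤ K) (hA : ∀ y, Continuous (A y))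
    (hA2 : ∀ n y y' x, Agree n y y' → |A y x - A y' x| ≤ K * Λ ^ n) :
    ∃ (φ : Shift r M → ℝ) (lam : ℝ), IsLip Λ φ ∧ ∀ y, Gplus A φ y = φ y + lam := by
  have hne : ∃ μ : Measure (Shift r M), InvProb μ := by
    obtain ⟨μ, h, _⟩ := exists_equilibrium hIrr hΛ x0 le_rfl (ALip.const Λ 0)
    exact ⟨μ, h⟩
  have hL : ∀ φ : C(Shift r M, ℝ), ALip Λ K (Gplus A φ) := fun φ =>
    Gplus_alip hne hA hA2 φ.continuous
  let T : C(Shift r M, ℝ) → C(Shift r M, ℝ) := fun φ => ⟨Gplus A φ, (hL φ).continuous hΛ⟩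
  have hT : ∀ φ y, T φ y = Gplus A φ y := fun _ _ => rfl
  obtain ⟨u, lam, hu, h⟩ := exists_fixed hΛ x0 T
    (fun φ ψ hφψ y => by
      have := Gplus_le_add hne hA φ.continuous ψ.continuous (y := y) (z := y) (c := 0)
        (fun x => by linarith [hφψ x])
      rw [hT, hT]; linarith)
    (fun φ c => by
      ext y
      have hc := (φ + ContinuousMap.const (Shift r M) c).continuous
      have h1 := Gplus_le_add hne hA hc φ.continuous (y := y) (z := y) (c := c)
        (fun x => by simp [add_assoc])
      have h2 := Gplus_le_add hne hA φ.continuous hc (y := y) (z := y) (c := -c)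
        (fun x => by simp [add_assoc])
      rw [ContinuousMap.add_apply, hT, hT, ContinuousMap.const_apply]
      linarith)
    K hK (fun φ t _ _ n x y hxy => hL (t • φ) (n+1) x y hxy)
    K (fun v t _ _ hv _ x y => by
      have h1 := hL (t • v) 0 x y (agree_zero x y)
      rw [← hT, ← hT, hv] at h1
      simpa using h1)
  exact ⟨u, lam, ⟨_, hu.lipBnd⟩, h⟩

lemma eigen_le {A : Shift r M → Shift r M → ℝ} (hne : ∃ μ : Measure (Shift r M), InvProb μ)
    (hA : ∀ y, Continuous (A y)) (x0 : Shift r M)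
    {φ ψ : Shift r M → ℝ} (hφ : Continuous φ) (hψ : Continuous ψ) {l m : ℝ}
    (h1 : ∀ y, Gplus A φ y = φ y + l) (h2 : ∀ y, Gplus A ψ y = ψ y + m) :
    ∃ y0, (∀ x, ψ x ≤ φ x + (ψ y0 - φ y0)) ∧ m ≤ l := by
  obtain ⟨y0, -, hy0⟩ := isCompact_univ.exists_isMaxOn (⟨x0, Set.mem_univ _⟩ : Set.univ.Nonempty)
    (hψ.sub hφ).continuousOn
  have hmax : ∀ x, ψ x ≤ φ x + (ψ y0 - φ y0) := fun x => by
    have h := hy0 (Set.mem_univ x)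
    simp only [Set.mem_ofPred_eq, Pi.sub_apply] at h
    linarith
  refine ⟨y0, hmax, ?_⟩
  have h3 := Gplus_le_add hne hA hψ hφ (y := y0) (z := y0) (c := ψ y0 - φ y0)
    (fun x => by linarith [hmax x])
  rw [h1, h2] at h3
  linarith

lemma unique_effective (hIrr : Irred M) {Λ : ℝ} (hΛ : Λ ∈ Set.Ioo (0 : ℝ) 1) (x0 : Shift r M)
    {A : Shift r M → Shift r M → ℝ} {K : ℝ} (hK : 0 ≤ K) (hA : ∀ y, ALip Λ K (A y))
    {φ ψ : Shift r M → ℝ} (hφ : IsLip Λ φ) (hψ : IsLip Λ ψ) {l m : ℝ}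
    (h1 : ∀ y, Gplus A φ y = φ y + l) (h2 : ∀ y, Gplus A ψ y = ψ y + m) :
    m = l ∧ ∃ c : ℝ, ∀ y, ψ y = φ y + c := by
  have hne : ∃ μ : Measure (Shift r M), InvProb μ := by
    obtain ⟨μ, h, _⟩ := exists_equilibrium hIrr hΛ x0 le_rfl (ALip.const Λ 0)
    exact ⟨μ, h⟩
  obtain ⟨K1, hφ⟩ := hφ
  obtain ⟨K2, hψ⟩ := hψ
  have aφ := hφ.aLip hΛ
  have aψ := hψ.aLip hΛ
  have cφ := aφ.continuous hΛ
  have cψ := aψ.continuous hΛ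
  have cA : ∀ y, Continuous (A y) := fun y => (hA y).continuous hΛ
  obtain ⟨y0, hmax, hml⟩ := eigen_le hne cA x0 cφ cψ h1 h2
  obtain ⟨_, _, hlm⟩ := eigen_le hne cA x0 cψ cφ h2 h1
  have hm : m = l := le_antisymm hml hlm
  refine ⟨hm, ψ y0 - φ y0, ?_⟩
  set c := ψ y0 - φ y0 with hc
  obtain ⟨μ, hμ, hfull, hsup⟩ := exists_equilibrium hIrr hΛ x0
    (add_nonneg hK (abs_nonneg K2)) ((hA y0).add aψ)
  have := hμ.1
  have hG : Gplus A ψ y0 ≤ ∫ x, (A y0 x + ψ x) ∂μ + entropy μ := by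
    refine csSup_le ⟨_, μ, hμ, rfl⟩ ?_
    rintro _ ⟨ν, hν, rfl⟩
    exact hsup ν hν
  have hG2 := le_Gplus cA cφ y0 hμ
  rw [h2] at hG
  rw [h1] at hG2
  have i1 := cont_integrable μ (cA y0)
  have i2 := cont_integrable μ cφ
  have i3 := cont_integrable μ cψ
  have e1 : ∫ x, (A y0 x + ψ x) ∂μ = ∫ x, A y0 x ∂μ + ∫ x, ψ x ∂μ := integral_add i1 i3
  have e2 : ∫ x, (A y0 x + φ x) ∂μ = ∫ x, A y0 x ∂μ + ∫ x, φ x ∂μ := integral_add i1 i2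
  have e3 : ∫ x, (φ x + c + -ψ x) ∂μ = ∫ x, φ x ∂μ + c - ∫ x, ψ x ∂μ := by
    have e4 : ∫ x, (φ x + c + -ψ x) ∂μ = ∫ x, (φ x + c) ∂μ + ∫ x, -ψ x ∂μ :=
      integral_add (i2.add (integrable_const c)) i3.neg
    have e5 : ∫ x, (φ x + c) ∂μ = ∫ x, φ x ∂μ + ∫ _x, c ∂μ :=
      integral_add i2 (integrable_const c)
    have e6 : ∫ _x : Shift r M, c ∂μ = c := by simp
    rw [e4, e5, e6, integral_neg]
    ring
  have hnn : ∀ x, 0 ≤ φ x + c + -ψ x := fun x => by linarith [hmax x]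
  have hz : ∫ x, (φ x + c + -ψ x) ∂μ = 0 := by
    refine le_antisymm ?_ (integral_nonneg hnn)
    rw [e3]
    linarith
  intro y
  have := hfull _ _ ((aφ.add (ALip.const Λ c)).add aψ.neg) hnn hz y
  linarith

/-- For a symmetric irreducible 0-1 transition matrix `M` and a
Lipschitz observable `A` on the natural extension, there exist a Lipschitz function
`φ⁺` (unique up to an additive constant) and a unique constant `λ⁺ ∈ ℝ` with
`G⁺_A(φ⁺) = φ⁺ + λ⁺`. -/
theorem effective_potential_exists_unique
    (r : ℕ) (hr : 2 ≤ r) (M : Fin r → Fin r → Bool)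
    (hSym : ∀ i j, M i j = M j i) (hIrr : Irred M)
    (Λ : ℝ) (hΛ : Λ ∈ Set.Ioo (0 : ℝ) 1)
    (A : Shift r M → Shift r M → ℝ) (hA : IsLip2 Λ A) :
    ∃ (φ : Shift r M → ℝ) (lam : ℝ),
      IsLip Λ φ ∧ (∀ y, Gplus A φ y = φ y + lam) ∧
      ∀ (φ' : Shift r M → ℝ) (lam' : ℝ),
        IsLip Λ φ' → (∀ y, Gplus A φ' y = φ' y + lam') →
          lam' = lam ∧ ∃ c : ℝ, ∀ y, φ' y = φ y + c := by
  obtain ⟨x0, -⟩ := exists_point hIrr ⟨0, by omega⟩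
  obtain ⟨K, hK⟩ := hA
  have hd : ∀ x : Shift r M, shiftDist Λ x x = 0 := fun x => by simp [shiftDist]
  have hA1 : ∀ y, ALip Λ |K| (A y) := fun y => LipBnd.aLip hΛ fun x x' => by
    have := hK y x y x'
    rwa [hd, max_eq_right (shiftDist_nonneg hΛ _ _)] at this
  have hA2 : ∀ n y y' x, Agree n y y' → |A y x - A y' x| ≤ |K| * Λ ^ n := by
    intro n y y' x hy
    have hl : LipBnd Λ K (fun y => A y x) := fun y y' => by
      have := hK y x y' x
      rwa [hd, max_eq_left (shiftDist_nonneg hΛ _ _)] at this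
    exact hl.aLip hΛ n y y' hy
  obtain ⟨φ, lam, hφ, h⟩ := exists_effective hIrr hΛ x0 (abs_nonneg K)
    (fun y => (hA1 y).continuous hΛ) hA2
  exact ⟨φ, lam, hφ, h, fun φ' lam' hφ' h' =>
    unique_effective hIrr hΛ x0 (abs_nonneg K) hA1 hφ hφ' h h'⟩
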